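/- Integration: Let κ ∈ (1,2), let A ⊂ [0,κ) be finite, let λ ∈ (0,1) and I := [λ,λ⁻¹]. Let U be a bounded function on ℝ²×ℝ² that is periodic and continuous in its second variable. Assume there exist an I-valued function a on ℝ² and a constant M̄ ≥ 0 such that for all x ∈ ℝ², all L ≤ 1 and all T with T^{1/4} ≤ 1: (T^{1/4})² inf_{c∈ℝ} ‖(∂₂ − a(x)∂₁²)U_T(x,·) − c‖_{B_L(x)} ≤ M̄ Σ_{β∈A} (T^{1/4})^{β} L^{κ−β}, where U_T(x,·) denotes mollification in the second argument, the operator ∂₂ − a(x)∂₁² acts in the second argument, and ‖·‖_{B_L(x)} is the sup norm over the d-ball of radius L centered at x. Assume further there exist γ ∈ C⁰(ℝ²×ℝ²) and M̄̄ ≥ 0 with the three-point continuity |U(x,z) − U(x,y) − U(y,z) + U(y,y) − γ(x,y)(z−y)₁| ≤ M̄̄ Σ_{β∈A} d^{β}(y,x) d^{κ−β}(z,y) for all x,y,z ∈ ℝ². Then there exists a function ν: ℝ² → ℝ such that M_U := sup_{x≠y} d^{−κ}(y,x)|U(x,y) − U(x,x) − ν(x)(y−x)₁| ≤ C(M̄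 + M̄̄); moreover sup_x |ν(x)| ≤ M_U and sup_{x≠y} d^{−(κ−1)}(y,x)|ν(y) − ν(x) + γ(x,y)| ≤ C(M_U + M̄̄) ≤ C'(M̄ + M̄̄), where C, C' depend only on λ, κ and A. -/

import Mathlib

open MeasureTheory

noncomputable section

/-- The parabolic metric `d(x,y) = |x₁−y₁| + √|x₂−y₂|` on `ℝ²`. -/
def pdist (x y : ℝ × ℝ) : ℝ := |x.1 - y.1| + Real.sqrt |x.2 - y.2|

/-- The kernel `ψ_T`, the inverse Fourier transform of `exp(−T(k₁⁴+k₂²))`. -/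
def psiK (T : ℝ) (x : ℝ × ℝ) : ℝ :=
  ∫ k : ℝ × ℝ, Real.exp (-(T * (k.1 ^ 4 + k.2 ^ 2))) *
    Real.cos (2 * Real.pi * (k.1 * x.1 + k.2 * x.2))

/-- Partial derivative in the first (space-like) variable. -/
def pd1 (g : ℝ × ℝ → ℝ) (x : ℝ × ℝ) : ℝ := deriv (fun s => g (s, x.2)) x.1

/-- Partial derivative in the second (time-like) variable. -/
def pd2 (g : ℝ × ℝ → ℝ) (x : ℝ × ℝ) : ℝ := deriv (fun s => g (x.1, s)) x.2

/-- Mollification of a scalar function at scale `t`. -/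
def mollS (t : ℝ) (g : ℝ × ℝ → ℝ) (x : ℝ × ℝ) : ℝ :=
  ∫ y : ℝ × ℝ, psiK t (x - y) * g y

/-- `[0,1)²`-periodicity. -/
def PeriodicFn {E : Type*} (g : ℝ × ℝ → E) : Prop :=
  ∀ (x : ℝ × ℝ) (k : ℤ × ℤ), g (x.1 + k.1, x.2 + k.2) = g x

namespace ParabolicKernel

open SchwartzMap FourierTransform

/-! ### The one-dimensional profiles -/

lemma abs_pow_mul_exp_le (n : ℕ) (hn : 1 ≤ n) (p : ℕ) (k : ℝ) :
    |k| ^ p * Real.exp (-k ^ (2 * n)) ≤ p.factorial * Real.exp 1 := by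
  have h1 : |k| ≤ 1 + k ^ (2 * n) := by
    have h0 : k ^ (2 * n) = |k| ^ (2 * n) := by rw [pow_mul, pow_mul, sq_abs]
    rw [h0]
    rcases le_total |k| 1 with h | h
    · have : 0 ≤ |k| ^ (2 * n) := by positivity
      linarith
    · have : |k| ^ 1 ≤ |k| ^ (2 * n) := pow_le_pow_right₀ h (by omega)
      simp only [pow_one] at this
      linarith
  have h2 := Real.pow_div_factorial_le_exp |k| (abs_nonneg k) p
  have h3 : Real.exp |k| ≤ Real.exp 1 * Real.exp (k ^ (2 * n)) := by
    rw [← Real.exp_add]; exact Real.exp_le_exp.mpr h1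
  have hf : (0 : ℝ) < p.factorial := by positivity
  rw [div_le_iff₀ hf] at h2
  rw [Real.exp_neg]
  rw [← div_eq_mul_inv, div_le_iff₀ (Real.exp_pos _)]
  nlinarith

lemma exists_bound_polynomial (n : ℕ) (hn : 1 ≤ n) (p : ℕ) (P : Polynomial ℝ) :
    ∃ C : ℝ, ∀ k : ℝ, |k| ^ p * |P.eval k * Real.exp (-k ^ (2 * n))| ≤ C := by
  induction P using Polynomial.induction_on' with
  | add P R hP hR =>
    obtain ⟨C, hC⟩ := hP
    obtain ⟨C', hC'⟩ := hR
    refine ⟨C + C', fun k => ?_⟩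
    rw [Polynomial.eval_add, add_mul]
    calc _ ≤ |k| ^ p * (|P.eval k * Real.exp (-k ^ (2 * n))| +
          |R.eval k * Real.exp (-k ^ (2 * n))|) := by gcongr; exact abs_add_le _ _
      _ ≤ _ := by rw [mul_add]; exact add_le_add (hC k) (hC' k)
  | monomial m a =>
    refine ⟨|a| * ((p + m).factorial * Real.exp 1), fun k => ?_⟩
    have := abs_pow_mul_exp_le n hn (p + m) k
    rw [Polynomial.eval_monomial, abs_mul, abs_mul, abs_of_pos (Real.exp_pos _), abs_pow]
    calc _ = |a| * (|k| ^ (p + m) * Real.exp (-k ^ (2 * n))) := by ring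
      _ ≤ _ := by gcongr

lemma exists_iteratedDeriv_exp (n : ℕ) (j : ℕ) :
    ∃ P : Polynomial ℝ, iteratedDeriv j (fun k : ℝ => Real.exp (-k ^ (2 * n))) =
      fun k => P.eval k * Real.exp (-k ^ (2 * n)) := by
  induction j with
  | zero => exact ⟨1, by simp⟩
  | succ j ih =>
    obtain ⟨P, hP⟩ := ih
    refine ⟨P.derivative - P * Polynomial.C (2 * n : ℝ) * Polynomial.X ^ (2 * n - 1), ?_⟩
    rw [iteratedDeriv_succ, hP]
    ext k
    have h1 := ((P.hasDerivAt k).mul (((hasDerivAt_pow (2 * n) k).neg).exp)).deriv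
    rw [show (fun k => P.eval k * Real.exp (-k ^ (2 * n))) =
      (fun x => P.eval x) * fun x => Real.exp ((-fun x => x ^ (2 * n)) x) from rfl, h1]
    simp
    ring

/-- The Schwartz function `exp (-k ^ (2 * n))`. -/
def expSchwartz (n : ℕ) (hn : 1 ≤ n) : 𝓢(ℝ, ℝ) where
  toFun k := Real.exp (-k ^ (2 * n))
  smooth' := by fun_prop
  decay' p j := by
    obtain ⟨P, hP⟩ := exists_iteratedDeriv_exp n j
    obtain ⟨C, hC⟩ := exists_bound_polynomial n hn p P
    refine ⟨C, fun k => ?_⟩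
    rw [norm_iteratedFDeriv_eq_norm_iteratedDeriv, hP]
    exact hC k

/-- The Schwartz function `exp (-(σ k) ^ (2 * n))`, complex valued. -/
def gaussS (n : ℕ) (hn : 1 ≤ n) (σ : ℝ) (hσ : σ ≠ 0) : 𝓢(ℝ, ℂ) :=
  postcompCLM (𝕜 := ℝ) Complex.ofRealCLM
    (compCLMOfContinuousLinearEquiv ℝ (ContinuousLinearEquiv.unitsEquivAut ℝ (Units.mk0 σ hσ))
      (expSchwartz n hn))

lemma gaussS_apply (n : ℕ) (hn : 1 ≤ n) (σ : ℝ) (hσ : σ ≠ 0) (k : ℝ) :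
    gaussS n hn σ hσ k = ((Real.exp (-(σ * k) ^ (2 * n)) : ℝ) : ℂ) := by
  have : gaussS n hn σ hσ k = ((expSchwartz n hn (k * σ) : ℝ) : ℂ) := rfl
  rw [this, mul_comm k σ]
  rfl

/-- The `i`-th derivative of the profile `f`, rescaled to scale `σ`. -/
def qk (f : 𝓢(ℝ, ℝ)) (i : ℕ) (σ x : ℝ) : ℝ := (σ⁻¹) ^ (i + 1) * iteratedDeriv i f (σ⁻¹ * x)

/-- The profile with Fourier transform `exp (-k ^ (2 * n))`. -/
def profile (n : ℕ) (hn : 1 ≤ n) : 𝓢(ℝ, ℝ) :=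
  postcompCLM (𝕜 := ℝ) Complex.reCLM (𝓕⁻ (gaussS n hn 1 one_ne_zero))

lemma integrable_exp_pow (n : ℕ) (hn : 1 ≤ n) (σ : ℝ) (hσ : σ ≠ 0) :
    Integrable fun k : ℝ => Real.exp (-(σ * k) ^ (2 * n)) := by
  have h := (gaussS n hn σ hσ).integrable (μ := volume)
  refine h.re.congr (Filter.Eventually.of_forall fun k => ?_)
  simp only [gaussS_apply]
  exact Complex.ofReal_re _

lemma integrable_exp_mul_cos (n : ℕ) (hn : 1 ≤ n) (σ : ℝ) (hσ : σ ≠ 0) (x : ℝ) :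
    Integrable fun k : ℝ =>
      Real.exp (-(σ * k) ^ (2 * n)) * Real.cos (2 * Real.pi * (k * x)) := by
  refine (integrable_exp_pow n hn σ hσ).mono' (by fun_prop)
    (Filter.Eventually.of_forall fun k => ?_)
  rw [norm_mul, Real.norm_eq_abs, abs_of_pos (Real.exp_pos _)]
  exact mul_le_of_le_one_right (Real.exp_pos _).le (Real.abs_cos_le_one _)

lemma integrable_exp_mul_sin (n : ℕ) (hn : 1 ≤ n) (σ : ℝ) (hσ : σ ≠ 0) (x : ℝ) :
    Integrable fun k : ℝ =>
      Real.exp (-(σ * k) ^ (2 * n)) * Real.sin (2 * Real.pi * (k * x)) := by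
  refine (integrable_exp_pow n hn σ hσ).mono' (by fun_prop)
    (Filter.Eventually.of_forall fun k => ?_)
  rw [norm_mul, Real.norm_eq_abs, abs_of_pos (Real.exp_pos _)]
  exact mul_le_of_le_one_right (Real.exp_pos _).le (Real.abs_sin_le_one _)

lemma integral_exp_mul_sin (n : ℕ) (σ x : ℝ) :
    ∫ k : ℝ, Real.exp (-(σ * k) ^ (2 * n)) * Real.sin (2 * Real.pi * (k * x)) = 0 := by
  have h1 := integral_neg_eq_self (fun k : ℝ =>
    Real.exp (-(σ * k) ^ (2 * n)) * Real.sin (2 * Real.pi * (k * x))) volume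
  have h2 : ∀ k : ℝ, Real.exp (-(σ * -k) ^ (2 * n)) * Real.sin (2 * Real.pi * (-k * x)) =
      -(Real.exp (-(σ * k) ^ (2 * n)) * Real.sin (2 * Real.pi * (k * x))) := by
    intro k
    rw [show 2 * Real.pi * (-k * x) = -(2 * Real.pi * (k * x)) by ring, Real.sin_neg,
      show σ * -k = -(σ * k) by ring, Even.neg_pow (even_two_mul n)]
    ring
  simp only [h2, integral_neg] at h1
  linarith

lemma fourierInv_gaussS (n : ℕ) (hn : 1 ≤ n) (σ : ℝ) (hσ : σ ≠ 0) (x : ℝ) :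
    (𝓕⁻ (gaussS n hn σ hσ)) x =
      ((∫ k : ℝ, Real.exp (-(σ * k) ^ (2 * n)) * Real.cos (2 * Real.pi * (k * x)) : ℝ) : ℂ) := by
  have hc := integrable_exp_mul_cos n hn σ hσ x
  have hs := integrable_exp_mul_sin n hn σ hσ x
  rw [fourierInv_coe, Real.fourierInv_eq']
  have h3 : ∀ k : ℝ, Complex.exp (((2 * Real.pi * inner ℝ k x : ℝ) : ℂ) * Complex.I) •
      (gaussS n hn σ hσ) k =
      ((Real.exp (-(σ * k) ^ (2 * n)) * Real.cos (2 * Real.pi * (k * x)) : ℝ) : ℂ) +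
      ((Real.exp (-(σ * k) ^ (2 * n)) * Real.sin (2 * Real.pi * (k * x)) : ℝ) : ℂ) *
        Complex.I := by
    intro k
    rw [gaussS_apply, Complex.exp_mul_I, ← Complex.ofReal_cos, ← Complex.ofReal_sin]
    have : inner ℝ k x = k * x := by simp [mul_comm]
    rw [this]
    push_cast
    simp only [smul_eq_mul]
    ring
  simp_rw [h3]
  rw [integral_add hc.ofReal (hs.ofReal.mul_const _), integral_mul_const,
    integral_complex_ofReal, integral_complex_ofReal, integral_exp_mul_sin]
  simp

lemma profile_apply (n : ℕ) (hn : 1 ≤ n) (x : ℝ) :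
    profile n hn x = ∫ k : ℝ, Real.exp (-k ^ (2 * n)) * Real.cos (2 * Real.pi * (k * x)) := by
  have : profile n hn x = ((𝓕⁻ (gaussS n hn 1 one_ne_zero)) x).re := rfl
  rw [this, fourierInv_gaussS]
  simp

lemma qk_profile (n : ℕ) (hn : 1 ≤ n) (σ : ℝ) (hσ : 0 < σ) (x : ℝ) :
    qk (profile n hn) 0 σ x =
      ∫ k : ℝ, Real.exp (-(σ * k) ^ (2 * n)) * Real.cos (2 * Real.pi * (k * x)) := by
  have h := Measure.integral_comp_mul_left (fun k : ℝ =>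
    Real.exp (-k ^ (2 * n)) * Real.cos (2 * Real.pi * (k * (σ⁻¹ * x)))) σ
  rw [abs_of_pos (inv_pos.mpr hσ), smul_eq_mul] at h
  rw [qk, iteratedDeriv_zero, profile_apply, zero_add, pow_one, ← h]
  congr 1
  ext k
  rw [show σ * k * (σ⁻¹ * x) = k * x by field_simp]

lemma fourierInv_gaussS_eq_qk (n : ℕ) (hn : 1 ≤ n) (σ : ℝ) (hσ : 0 < σ) (x : ℝ) :
    (𝓕⁻ (gaussS n hn σ hσ.ne')) x = ((qk (profile n hn) 0 σ x : ℝ) : ℂ) := by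
  rw [qk_profile n hn σ hσ, fourierInv_gaussS]

lemma profile_even (n : ℕ) (hn : 1 ≤ n) (x : ℝ) : profile n hn (-x) = profile n hn x := by
  rw [profile_apply, profile_apply]
  congr 1
  ext k
  rw [show 2 * Real.pi * (k * -x) = -(2 * Real.pi * (k * x)) by ring, Real.cos_neg]

lemma profile_ofReal (n : ℕ) (hn : 1 ≤ n) (x : ℝ) :
    ((profile n hn x : ℝ) : ℂ) = 𝓕⁻ (gaussS n hn 1 one_ne_zero) x := by
  rw [fourierInv_gaussS, profile_apply]
  simp

lemma integral_profile (n : ℕ) (hn : 1 ≤ n) : ∫ x, profile n hn x = 1 := by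
  have h : 𝓕 (𝓕⁻ (gaussS n hn 1 one_ne_zero)) 0 = gaussS n hn 1 one_ne_zero 0 := by simp
  rw [fourier_coe, Real.fourier_eq'] at h
  simp only [inner_zero_right, mul_zero, Complex.ofReal_zero, zero_mul, Complex.exp_zero,
    one_smul, ← profile_ofReal, gaussS_apply] at h
  rw [integral_complex_ofReal] at h
  have hn' : n ≠ 0 := by omega
  simpa [hn'] using h

lemma integral_qk_conv (n : ℕ) (hn : 1 ≤ n) (σ τ ρ : ℝ) (hσ : 0 < σ) (hτ : 0 < τ) (hρ : 0 < ρ)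
    (h : ρ ^ (2 * n) = σ ^ (2 * n) + τ ^ (2 * n)) (x : ℝ) :
    ∫ y, qk (profile n hn) 0 σ (x - y) * qk (profile n hn) 0 τ y = qk (profile n hn) 0 ρ x := by
  have hp : pairing (ContinuousLinearMap.mul ℂ ℂ) (gaussS n hn τ hτ.ne') (gaussS n hn σ hσ.ne') =
      gaussS n hn ρ hρ.ne' := by
    ext k
    rw [pairing_apply_apply]
    simp only [gaussS_apply, ContinuousLinearMap.mul_apply']
    rw [← Complex.ofReal_mul, ← Real.exp_add]
    congr 2
    rw [mul_pow, mul_pow, mul_pow, h]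
    ring
  have h1 := SchwartzMap.convolution_apply (ContinuousLinearMap.mul ℂ ℂ) (𝓕⁻ (gaussS n hn τ hτ.ne'))
    (𝓕⁻ (gaussS n hn σ hσ.ne')) x
  have h2 : SchwartzMap.convolution (ContinuousLinearMap.mul ℂ ℂ) (𝓕⁻ (gaussS n hn τ hτ.ne'))
    (𝓕⁻ (gaussS n hn σ hσ.ne')) = 𝓕⁻ (gaussS n hn ρ hρ.ne') := by
    simp [SchwartzMap.convolution, hp]
  rw [h2, MeasureTheory.convolution] at h1
  simp only [fourierInv_gaussS_eq_qk n hn _ hρ, fourierInv_gaussS_eq_qk n hn _ hσ,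
    fourierInv_gaussS_eq_qk n hn _ hτ, ContinuousLinearMap.mul_apply', ← Complex.ofReal_mul] at h1
  rw [integral_complex_ofReal] at h1
  rw [Complex.ofReal_inj.mp h1]
  congr 1; ext y; ring

lemma iteratedDeriv_ofReal_comp (f : 𝓢(ℝ, ℝ)) (j : ℕ) (x : ℝ) :
    iteratedDeriv j (fun x => ((f x : ℝ) : ℂ)) x = ((iteratedDeriv j f x : ℝ) : ℂ) := by
  induction j generalizing x with
  | zero => simp
  | succ j ih =>
    rw [iteratedDeriv_succ, funext ih, iteratedDeriv_succ]
    have : DifferentiableAt ℝ (iteratedDeriv j f) x :=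
      ((f.smooth ⊤).differentiable_iteratedDeriv j (by exact_mod_cast ENat.natCast_lt_top j)) x
    exact this.hasDerivAt.ofReal_comp.deriv

lemma iteratedDeriv_profile (n : ℕ) (hn : 1 ≤ n) (x : ℝ) :
    (2 * n : ℝ) * iteratedDeriv (2 * n - 1) (profile n hn) x =
      (-1) ^ n * (2 * Real.pi) ^ (2 * n) * (x * profile n hn x) := by
  set g := gaussS n hn 1 one_ne_zero with hg
  have hF : 𝓕 (g : ℝ → ℂ) = fun x => ((profile n hn x : ℝ) : ℂ) := by
    ext x
    rw [← neg_neg x, ← Real.fourierInv_eq_fourier_neg, ← fourierInv_coe, hg, ← profile_ofReal,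
      profile_even, neg_neg]
  have hgd : ∀ k, deriv (g : ℝ → ℂ) k = (-(2 * n : ℂ)) * ((k : ℂ) ^ (2 * n - 1) * g k) := by
    intro k
    have : (g : ℝ → ℂ) = fun k => ((Real.exp (-(k) ^ (2 * n)) : ℝ) : ℂ) := by
      ext k; rw [hg, gaussS_apply, one_mul]
    rw [this]
    have h1 := ((((hasDerivAt_pow (2 * n) k).neg).exp)).ofReal_comp.deriv
    refine Eq.trans ?_ (h1.trans ?_)
    · rfl
    · push_cast
      simp
      ring
  have hInt : ∀ p : ℕ, Integrable (fun k : ℝ => k ^ p • g k) := by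
    intro p
    have := (g.integrable_pow_mul volume p)
    refine this.mono' (by fun_prop) (Filter.Eventually.of_forall fun k => ?_)
    rw [norm_smul, norm_pow]
  have h1 := Real.iteratedDeriv_fourier (f := (g : ℝ → ℂ)) (N := ⊤) (n := 2 * n - 1)
    (fun p _ => hInt p) le_top
  have h2 := Real.fourier_deriv (f := (g : ℝ → ℂ)) g.integrable
    g.differentiable (by
      have := (derivCLM ℝ ℂ g).integrable (μ := volume)
      exact this)
  have e1 := congrFun h1 x
  have e2 := congrFun h2 x
  rw [hF] at e1 e2
  rw [iteratedDeriv_ofReal_comp] at e1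
  have e3 : (2 * n : ℂ) * 𝓕 (fun k : ℝ => (-2 * Real.pi * Complex.I * k) ^ (2 * n - 1) • g k) x =
      -(-2 * Real.pi * Complex.I) ^ (2 * n - 1) * 𝓕 (deriv g) x := by
    rw [Real.fourier_eq, Real.fourier_eq, ← integral_const_mul, ← integral_const_mul]
    congr 1
    ext k
    simp only [Circle.smul_def, smul_eq_mul, hgd]
    ring
  rw [← e1, e2] at e3
  apply Complex.ofReal_injective
  have hI : (Complex.I) ^ (2 * n) = (-1) ^ n := by rw [pow_mul, Complex.I_sq]
  have h4 : (-2 * Real.pi * Complex.I) ^ (2 * n - 1) * (-2 * Real.pi * Complex.I) =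
      (-1) ^ n * (2 * Real.pi) ^ (2 * n) := by
    rw [← pow_succ, show 2 * n - 1 + 1 = 2 * n by omega, mul_pow, hI,
      show (-2 * Real.pi : ℂ) = -(2 * Real.pi) by ring, Even.neg_pow (even_two_mul n)]
    ring
  push_cast
  rw [e3, ← h4, smul_eq_mul]
  ring

/-! ### Rescaled derivatives of a Schwartz function -/

lemma exists_schwartz_iteratedDeriv (f : 𝓢(ℝ, ℝ)) (i : ℕ) :
    ∃ g : 𝓢(ℝ, ℝ), iteratedDeriv i f = g := by
  induction i with
  | zero => exact ⟨f, by simp⟩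
  | succ i ih =>
    obtain ⟨g, hg⟩ := ih
    exact ⟨derivCLM ℝ ℝ g, by rw [iteratedDeriv_succ, hg]; rfl⟩

lemma exists_decay (f : 𝓢(ℝ, ℝ)) (i p : ℕ) :
    ∃ C : ℝ, 0 < C ∧ ∀ t, (1 + |t|) ^ p * |iteratedDeriv i f t| ≤ C := by
  have h := fun t => one_add_le_sup_seminorm_apply (𝕜 := ℝ) (m := (p, i)) (k := p) (n := i)
    le_rfl le_rfl f t
  simp only [norm_iteratedFDeriv_eq_norm_iteratedDeriv, Real.norm_eq_abs] at h
  refine ⟨_ + 1, ?_, fun t => (h t).trans (le_add_of_nonneg_right zero_le_one)⟩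
  have := h 0
  have h0 : 0 ≤ (1 + |(0 : ℝ)|) ^ p * |iteratedDeriv i f 0| := by positivity
  linarith

lemma hasDerivAt_iteratedDeriv (f : 𝓢(ℝ, ℝ)) (i : ℕ) (x : ℝ) :
    HasDerivAt (iteratedDeriv i f) (iteratedDeriv (i + 1) f x) x := by
  obtain ⟨g, hg⟩ := exists_schwartz_iteratedDeriv f i
  rw [iteratedDeriv_succ, hg]
  exact (g.differentiable x).hasDerivAt

lemma hasDerivAt_qk (f : 𝓢(ℝ, ℝ)) (i : ℕ) (σ x : ℝ) :
    HasDerivAt (qk f i σ) (qk f (i + 1) σ x) x := by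
  have h1 : HasDerivAt (fun y : ℝ => σ⁻¹ * y) σ⁻¹ x := by
    simpa using (hasDerivAt_id x).const_mul σ⁻¹
  have h2 := ((hasDerivAt_iteratedDeriv f i (σ⁻¹ * x)).comp x h1).const_mul ((σ⁻¹) ^ (i + 1))
  refine h2.congr_deriv ?_
  rw [qk]; ring

lemma continuous_qk (f : 𝓢(ℝ, ℝ)) (i : ℕ) (σ : ℝ) : Continuous (qk f i σ) :=
  continuous_iff_continuousAt.mpr fun x => (hasDerivAt_qk f i σ x).continuousAt

lemma qk_le_of_near (f : 𝓢(ℝ, ℝ)) (i : ℕ) (σ₀ : ℝ) (hσ : 0 < σ₀) :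
    ∃ C : ℝ, 0 < C ∧ ∀ σ ∈ Set.Icc (σ₀ / 2) (2 * σ₀), ∀ z z₀ y : ℝ, |z - z₀| ≤ 1 →
      |qk f i σ (z - y)| ≤ C * (1 + (z₀ - y) ^ 2)⁻¹ := by
  obtain ⟨C, hC0, hC⟩ := exists_decay f i 2
  refine ⟨(2 * σ₀⁻¹) ^ (i + 1) * (C * (3 + 8 * σ₀ ^ 2)), by positivity, fun σ hs z z₀ y hz => ?_⟩
  have hs0 : 0 < σ := by linarith [hs.1]
  set t := σ⁻¹ * (z - y) with ht
  have hzt : z - y = σ * t := by rw [ht]; field_simp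
  have h1 : 1 + (z₀ - y) ^ 2 ≤ (3 + 8 * σ₀ ^ 2) * (1 + |t|) ^ 2 := by
    have e1 : (z₀ - y) ^ 2 ≤ 2 * (z - y) ^ 2 + 2 := by
      have : (z - z₀) ^ 2 ≤ 1 := by
        rw [← sq_abs]; nlinarith [abs_nonneg (z - z₀)]
      nlinarith [sq_nonneg ((z - y) + (z - z₀))]
    have e2 : (z - y) ^ 2 ≤ 4 * σ₀ ^ 2 * t ^ 2 := by
      rw [hzt, mul_pow]
      have : σ ^ 2 ≤ 4 * σ₀ ^ 2 := by nlinarith [hs.2]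
      gcongr
    have e3 : 1 + t ^ 2 ≤ (1 + |t|) ^ 2 := by
      nlinarith [abs_nonneg t, sq_abs t]
    calc 1 + (z₀ - y) ^ 2 ≤ (3 + 8 * σ₀ ^ 2) * (1 + t ^ 2) := by nlinarith [sq_nonneg σ₀, sq_nonneg t]
      _ ≤ _ := by gcongr
  have h2 : |iteratedDeriv i f t| ≤ C * (3 + 8 * σ₀ ^ 2) * (1 + (z₀ - y) ^ 2)⁻¹ := by
    rw [← div_eq_mul_inv, le_div_iff₀ (by positivity)]
    calc |iteratedDeriv i f t| * (1 + (z₀ - y) ^ 2) ≤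
        |iteratedDeriv i f t| * ((3 + 8 * σ₀ ^ 2) * (1 + |t|) ^ 2) := by gcongr
      _ = (3 + 8 * σ₀ ^ 2) * ((1 + |t|) ^ 2 * |iteratedDeriv i f t|) := by ring
      _ ≤ (3 + 8 * σ₀ ^ 2) * C := by gcongr; exact hC t
      _ = _ := by ring
  have h3 : σ⁻¹ ≤ 2 * σ₀⁻¹ := by
    have : σ⁻¹ ≤ (σ₀ / 2)⁻¹ := inv_anti₀ (by positivity) hs.1
    simpa [div_eq_mul_inv, mul_comm] using this
  rw [qk, abs_mul, abs_of_pos (by positivity : 0 < σ⁻¹ ^ (i + 1)), ← ht, mul_assoc]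
  gcongr

lemma integrable_inv_one_add_sub_sq (z : ℝ) : Integrable fun y : ℝ => (1 + (z - y) ^ 2)⁻¹ :=
  integrable_inv_one_add_sq.comp_sub_left z

lemma qk_weight (f : 𝓢(ℝ, ℝ)) (i n : ℕ) (m M : ℝ) (hm : 0 < m) :
    ∃ C : ℝ, 0 < C ∧ ∀ A ∈ Set.Icc m M, ∀ s : ℝ, 0 < s →
      Integrable (fun w => |qk f i (A * s) w| * (1 + |w| / s) ^ n) ∧
      ∫ w, |qk f i (A * s) w| * (1 + |w| / s) ^ n ≤ C * (s⁻¹) ^ i := by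
  obtain ⟨C₀, hC0, hC⟩ := exists_decay f i (n + 2)
  refine ⟨(m⁻¹) ^ i * ((1 + |M|) ^ n * C₀ * ∫ t : ℝ, (1 + t ^ 2)⁻¹), ?_, fun A hA s hs => ?_⟩
  · rw [integral_univ_inv_one_add_sq]
    positivity
  have hA0 : 0 < A := hm.trans_le hA.1
  set F : ℝ → ℝ := fun t => |iteratedDeriv i f t| * (1 + A * |t|) ^ n with hF
  have hFc : Continuous F := by
    have : Continuous (iteratedDeriv i f) :=
      continuous_iff_continuousAt.mpr fun x => (hasDerivAt_iteratedDeriv f i x).continuousAt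
    fun_prop
  have hFb : ∀ t, F t ≤ (1 + |M|) ^ n * C₀ * (1 + t ^ 2)⁻¹ := by
    intro t
    have e1 : 1 + A * |t| ≤ (1 + |M|) * (1 + |t|) := by
      have : A ≤ |M| := hA.2.trans (le_abs_self M)
      nlinarith [abs_nonneg t, abs_nonneg M]
    have e3 : 1 + t ^ 2 ≤ (1 + |t|) ^ 2 := by nlinarith [abs_nonneg t, sq_abs t]
    rw [← div_eq_mul_inv, le_div_iff₀ (by positivity)]
    calc F t * (1 + t ^ 2) ≤ |iteratedDeriv i f t| * ((1 + |M|) * (1 + |t|)) ^ n *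
          (1 + |t|) ^ 2 := by
          change |iteratedDeriv i f t| * (1 + A * |t|) ^ n * (1 + t ^ 2) ≤ _
          gcongr
      _ = (1 + |M|) ^ n * ((1 + |t|) ^ (n + 2) * |iteratedDeriv i f t|) := by
          rw [mul_pow]; ring
      _ ≤ _ := by gcongr; exact hC t
  have hF0 : ∀ t, 0 ≤ F t := fun t => by rw [hF]; positivity
  have hFi : Integrable F := by
    refine (integrable_inv_one_add_sq.const_mul ((1 + |M|) ^ n * C₀)).mono'
      hFc.aestronglyMeasurable (Filter.Eventually.of_forall fun t => ?_)
    rw [Real.norm_eq_abs, abs_of_nonneg (hF0 t)]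
    exact hFb t
  have hAs : 0 < A * s := by positivity
  have hEq : ∀ w, |qk f i (A * s) w| * (1 + |w| / s) ^ n =
      ((A * s)⁻¹) ^ (i + 1) * F ((A * s)⁻¹ * w) := by
    intro w
    rw [qk, abs_mul, abs_of_pos (by positivity : 0 < (A * s)⁻¹ ^ (i + 1)), hF]
    simp only
    rw [abs_mul, abs_of_pos (inv_pos.mpr hAs), mul_assoc]
    congr 3
    field_simp
  simp_rw [hEq]
  refine ⟨(hFi.comp_mul_left' (inv_pos.mpr hAs).ne').const_mul _, ?_⟩
  rw [integral_const_mul, Measure.integral_comp_mul_left, inv_inv, abs_of_pos hAs, smul_eq_mul]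
  have hle : ∫ t, F t ≤ (1 + |M|) ^ n * C₀ * ∫ t : ℝ, (1 + t ^ 2)⁻¹ := by
    rw [← integral_const_mul]
    exact integral_mono hFi (integrable_inv_one_add_sq.const_mul _) hFb
  calc (A * s)⁻¹ ^ (i + 1) * (A * s * ∫ t, F t) = (A⁻¹) ^ i * (s⁻¹) ^ i * ∫ t, F t := by
        rw [pow_succ, ← mul_pow, mul_inv]; field_simp
    _ ≤ (m⁻¹) ^ i * (s⁻¹) ^ i * ((1 + |M|) ^ n * C₀ * ∫ t : ℝ, (1 + t ^ 2)⁻¹) := by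
        have : A⁻¹ ≤ m⁻¹ := inv_anti₀ hm hA.1
        have h0 : 0 ≤ ∫ t, F t := integral_nonneg hF0
        gcongr
    _ = _ := by ring

lemma integrable_qk (f : 𝓢(ℝ, ℝ)) (i : ℕ) (σ : ℝ) (hσ : 0 < σ) : Integrable (qk f i σ) := by
  obtain ⟨C, -, h⟩ := qk_weight f i 0 1 1 one_pos
  have := (h 1 (by simp) σ hσ).1
  simp only [one_mul, pow_zero, mul_one] at this
  exact this.mono (continuous_qk f i σ).aestronglyMeasurable (by simp)

lemma abs_qk_le (f : 𝓢(ℝ, ℝ)) (i : ℕ) (σ : ℝ) : ∃ C, 0 < C ∧ ∀ x, |qk f i σ x| ≤ C := by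
  obtain ⟨C, hC, h⟩ := exists_decay f i 0
  refine ⟨|σ⁻¹ ^ (i + 1)| * C + 1, by positivity, fun x => ?_⟩
  rw [qk, abs_mul]
  have := h (σ⁻¹ * x)
  simp only [pow_zero, one_mul] at this
  have : |σ⁻¹ ^ (i + 1)| * |iteratedDeriv i f (σ⁻¹ * x)| ≤ |σ⁻¹ ^ (i + 1)| * C := by gcongr
  linarith

lemma tendsto_qk_cocompact (f : 𝓢(ℝ, ℝ)) (i : ℕ) (σ : ℝ) (hσ : 0 < σ) :
    Filter.Tendsto (qk f i σ) (Filter.cocompact ℝ) (nhds 0) := by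
  obtain ⟨g, hg⟩ := exists_schwartz_iteratedDeriv f i
  have h1 : Filter.Tendsto (fun x : ℝ => σ⁻¹ * x) (Filter.cocompact ℝ) (Filter.cocompact ℝ) :=
    (Homeomorph.mulLeft₀ σ⁻¹ (inv_pos.mpr hσ).ne').isClosedEmbedding.tendsto_cocompact
  have h2 := ((g.toZeroAtInfty.zero_at_infty').comp h1).const_mul (σ⁻¹ ^ (i + 1))
  simp only [mul_zero] at h2
  refine h2.congr fun x => ?_
  rw [qk, hg]
  rfl

lemma integral_qk_succ (f : 𝓢(ℝ, ℝ)) (i : ℕ) (σ : ℝ) (hσ : 0 < σ) :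
    ∫ x, qk f (i + 1) σ x = 0 := by
  have h := tendsto_qk_cocompact f i σ hσ
  have := integral_of_hasDerivAt_of_tendsto (fun x => hasDerivAt_qk f i σ x)
    (integrable_qk f (i + 1) σ hσ) (h.mono_left _root_.atBot_le_cocompact)
    (h.mono_left _root_.atTop_le_cocompact)
  simpa using this

lemma integral_qk_zero (n : ℕ) (hn : 1 ≤ n) (σ : ℝ) (hσ : 0 < σ) :
    ∫ x, qk (profile n hn) 0 σ x = 1 := by
  simp only [qk, iteratedDeriv_zero]
  rw [integral_const_mul, Measure.integral_comp_mul_left, integral_profile, inv_inv,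
    abs_of_pos hσ]
  simp [hσ.ne']

lemma integral_id_mul_qk (n : ℕ) (hn : 1 ≤ n) (σ : ℝ) :
    ∫ x, x * qk (profile n hn) 0 σ x = 0 := by
  have h1 := integral_neg_eq_self (fun x => x * qk (profile n hn) 0 σ x) volume
  have h2 : ∀ x, -x * qk (profile n hn) 0 σ (-x) = -(x * qk (profile n hn) 0 σ x) := by
    intro x
    simp only [qk, iteratedDeriv_zero, mul_neg, profile_even]
    ring
  simp only [h2, integral_neg] at h1
  linarith

lemma qk_conv (n : ℕ) (hn : 1 ≤ n) (i j : ℕ) (σ τ ρ : ℝ) (hσ : 0 < σ) (hτ : 0 < τ) (hρ : 0 < ρ)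
    (h : ρ ^ (2 * n) = σ ^ (2 * n) + τ ^ (2 * n)) (x : ℝ) :
    ∫ y, qk (profile n hn) i σ (x - y) * qk (profile n hn) j τ y =
      qk (profile n hn) (i + j) ρ x := by
  have step : ∀ (i j : ℕ) (σ τ : ℝ), 0 < σ → 0 < τ →
      (∀ x, ∫ y, qk (profile n hn) i σ (x - y) * qk (profile n hn) j τ y =
        qk (profile n hn) (i + j) ρ x) →
      ∀ x, ∫ y, qk (profile n hn) (i + 1) σ (x - y) * qk (profile n hn) j τ y =
        qk (profile n hn) (i + 1 + j) ρ x := by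
    intro i j σ τ hσ hτ ih x
    obtain ⟨C, hC0, hC⟩ := abs_qk_le (profile n hn) (i + 1) σ
    obtain ⟨C', hC0', hC'⟩ := abs_qk_le (profile n hn) i σ
    have hd := hasDerivAt_integral_of_dominated_loc_of_deriv_le (μ := volume)
      (F := fun x y => qk (profile n hn) i σ (x - y) * qk (profile n hn) j τ y)
      (F' := fun x y => qk (profile n hn) (i + 1) σ (x - y) * qk (profile n hn) j τ y)
      (x₀ := x) (s := Set.univ) (bound := fun y => C * |qk (profile n hn) j τ y|)
      Filter.univ_mem
      (Filter.Eventually.of_forall fun x => by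
        have h1 := continuous_qk (profile n hn) i σ
        have h2 := continuous_qk (profile n hn) j τ
        exact (by fun_prop : Continuous fun y =>
          qk (profile n hn) i σ (x - y) * qk (profile n hn) j τ y).aestronglyMeasurable)
      ((integrable_qk _ j τ hτ).bdd_mul (c := C')
        (by
          have h1 := continuous_qk (profile n hn) i σ
          exact (by fun_prop : Continuous fun y =>
            qk (profile n hn) i σ (x - y)).aestronglyMeasurable)
        (Filter.Eventually.of_forall fun y => hC' _))
      (by
        have h1 := continuous_qk (profile n hn) (i + 1) σ
        have h2 := continuous_qk (profile n hn) j τ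
        exact (by fun_prop : Continuous fun y =>
          qk (profile n hn) (i + 1) σ (x - y) * qk (profile n hn) j τ y).aestronglyMeasurable)
      (Filter.Eventually.of_forall fun y x _ => by
        rw [norm_mul]
        exact mul_le_mul_of_nonneg_right (hC _) (norm_nonneg _))
      ((integrable_qk _ j τ hτ).norm.const_mul C)
      (Filter.Eventually.of_forall fun y x _ => by
        have h1 : HasDerivAt (fun x : ℝ => x - y) 1 x := (hasDerivAt_id x).sub_const y
        have h2 := ((hasDerivAt_qk (profile n hn) i σ (x - y)).comp x h1).mul_const
          (qk (profile n hn) j τ y)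
        rw [mul_one] at h2
        exact h2)
    have h3 := hd.2
    rw [show (fun x => ∫ y, qk (profile n hn) i σ (x - y) * qk (profile n hn) j τ y) =
      qk (profile n hn) (i + j) ρ from funext ih] at h3
    rw [h3.unique (hasDerivAt_qk _ _ _ _)]
    congr 1
    ring
  have zero_right : ∀ (i : ℕ) (σ τ : ℝ), 0 < σ → 0 < τ →
      ρ ^ (2 * n) = σ ^ (2 * n) + τ ^ (2 * n) → ∀ x,
      ∫ y, qk (profile n hn) i σ (x - y) * qk (profile n hn) 0 τ y =
        qk (profile n hn) (i + 0) ρ x := by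
    intro i σ τ hσ hτ hh
    induction i with
    | zero => exact fun x => integral_qk_conv n hn σ τ ρ hσ hτ hρ hh x
    | succ i ih => exact step i 0 σ τ hσ hτ ih
  have zero_left : ∀ x, ∫ y, qk (profile n hn) 0 σ (x - y) * qk (profile n hn) j τ y =
        qk (profile n hn) (0 + j) ρ x := by
    intro x
    have h1 := zero_right j τ σ hτ hσ (by rw [h, add_comm]) x
    rw [zero_add, ← add_zero j, ← h1, ← integral_sub_left_eq_self _ volume x]
    congr 1
    ext y
    rw [sub_sub_cancel, mul_comm, add_zero]
  have : ∀ x, ∫ y, qk (profile n hn) i σ (x - y) * qk (profile n hn) j τ y =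
        qk (profile n hn) (i + j) ρ x := by
    induction i with
    | zero => exact zero_left
    | succ i ih => exact step i j σ τ hσ hτ ih
  exact this x

lemma iteratedDeriv_id_mul (f : 𝓢(ℝ, ℝ)) (i : ℕ) (x : ℝ) :
    iteratedDeriv (i + 1) (fun x => x * f x) x =
      (i + 1) * iteratedDeriv i f x + x * iteratedDeriv (i + 1) f x := by
  induction i generalizing x with
  | zero =>
    have h1 := (hasDerivAt_id x).mul (hasDerivAt_iteratedDeriv f 0 x)
    simp only [iteratedDeriv_zero] at h1
    rw [iteratedDeriv_one]
    refine Eq.trans ?_ (h1.deriv.trans ?_)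
    · rfl
    · simp
  | succ i ih =>
    rw [iteratedDeriv_succ, funext ih]
    have h1 := ((hasDerivAt_iteratedDeriv f i x).const_mul (i + 1 : ℝ)).add
      ((hasDerivAt_id x).mul (hasDerivAt_iteratedDeriv f (i + 1) x))
    refine Eq.trans ?_ (h1.deriv.trans ?_)
    · rfl
    · simp; ring

/-- The constant in `x q(x) = c q^{(2 * n - 1)}(x)` for the profile `q`. -/
def odeConst (n : ℕ) : ℝ := (-1) ^ n * (2 * n) / (2 * Real.pi) ^ (2 * n)

lemma id_mul_profile (n : ℕ) (hn : 1 ≤ n) (x : ℝ) :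
    x * profile n hn x = odeConst n * iteratedDeriv (2 * n - 1) (profile n hn) x := by
  have h := iteratedDeriv_profile n hn x
  have hs : ((-1 : ℝ) ^ n) * (-1) ^ n = 1 := by rw [← mul_pow]; simp
  rw [odeConst, div_mul_eq_mul_div, eq_div_iff (by positivity)]
  linear_combination (-(-1) ^ n) * h - (x * profile n hn x * (2 * Real.pi) ^ (2 * n)) * hs

lemma hasDerivAt_qk_scale (n : ℕ) (hn : 1 ≤ n) (i : ℕ) (σ : ℝ) (hσ : σ ≠ 0) (x : ℝ) :
    HasDerivAt (fun σ => qk (profile n hn) i σ x)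
      (-(odeConst n) * σ ^ (2 * n - 1) * qk (profile n hn) (i + 2 * n) σ x) σ := by
  have h1 : HasDerivAt (fun σ : ℝ => σ⁻¹) (-(σ ^ 2)⁻¹) σ := hasDerivAt_inv hσ
  have h2 := (h1.pow (i + 1)).mul
    ((hasDerivAt_iteratedDeriv (profile n hn) i (σ⁻¹ * x)).comp σ (h1.mul_const x))
  refine h2.congr_deriv ?_
  have h3 := iteratedDeriv_id_mul (profile n hn) i (σ⁻¹ * x)
  rw [show (fun x => x * profile n hn x) = fun x =>
    odeConst n * iteratedDeriv (2 * n - 1) (profile n hn) x from funext (id_mul_profile n hn)] at h3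
  have h4 : iteratedDeriv (i + 1) (fun x => odeConst n * iteratedDeriv (2 * n - 1)
      (profile n hn) x) (σ⁻¹ * x) = odeConst n * iteratedDeriv (i + 2 * n) (profile n hn) (σ⁻¹ * x) := by
    rw [iteratedDeriv_const_mul_field, iteratedDeriv_eq_iterate (n := 2 * n - 1),
      iteratedDeriv_eq_iterate (n := i + 1), ← Function.iterate_add_apply,
      iteratedDeriv_eq_iterate, show i + 1 + (2 * n - 1) = i + 2 * n by omega]
  rw [h4] at h3
  have h5 : σ ^ (2 * n - 1) * (σ⁻¹) ^ (i + 2 * n + 1) = (σ⁻¹) ^ (i + 2) := by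
    rw [show i + 2 * n + 1 = (2 * n - 1) + (i + 2) by omega, pow_add, ← mul_assoc, ← mul_pow,
      mul_inv_cancel₀ hσ, one_pow, one_mul]
  rw [qk, show -(odeConst n) * σ ^ (2 * n - 1) * (σ⁻¹ ^ (i + 2 * n + 1) *
    iteratedDeriv (i + 2 * n) (profile n hn) (σ⁻¹ * x)) = -((σ ^ (2 * n - 1) *
    σ⁻¹ ^ (i + 2 * n + 1)) * (odeConst n * iteratedDeriv (i + 2 * n) (profile n hn) (σ⁻¹ * x)))
    by ring, h5, h3]
  simp only [Pi.pow_apply, Nat.add_sub_cancel, Function.comp]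
  push_cast
  rw [← inv_pow]
  ring

/-! ### The parabolic distance -/

lemma pdist_nonneg (x y : ℝ × ℝ) : 0 ≤ pdist x y := by unfold pdist; positivity

lemma pdist_self (x : ℝ × ℝ) : pdist x x = 0 := by simp [pdist]

lemma pdist_comm (x y : ℝ × ℝ) : pdist x y = pdist y x := by
  rw [pdist, pdist, abs_sub_comm, abs_sub_comm x.2]

lemma sqrt_abs_add_le (a b : ℝ) : √|a + b| ≤ √|a| + √|b| := by
  rw [Real.sqrt_le_left (by positivity)]
  nlinarith [abs_add_le a b, Real.sq_sqrt (abs_nonneg a), Real.sq_sqrt (abs_nonneg b),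
    Real.sqrt_nonneg |a|, Real.sqrt_nonneg |b|,
    mul_nonneg (Real.sqrt_nonneg |a|) (Real.sqrt_nonneg |b|)]

lemma pdist_triangle (x y z : ℝ × ℝ) : pdist x z ≤ pdist x y + pdist y z := by
  unfold pdist
  have h1 := abs_add_le (x.1 - y.1) (y.1 - z.1)
  have h2 := sqrt_abs_add_le (x.2 - y.2) (y.2 - z.2)
  rw [sub_add_sub_cancel] at h1 h2
  linarith

lemma abs_fst_sub_le_pdist (x y : ℝ × ℝ) : |x.1 - y.1| ≤ pdist x y := by
  unfold pdist; linarith [Real.sqrt_nonneg |x.2 - y.2|]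

lemma abs_snd_sub_le_pdist_sq (x y : ℝ × ℝ) : |x.2 - y.2| ≤ pdist x y ^ 2 := by
  unfold pdist
  nlinarith [Real.sq_sqrt (abs_nonneg (x.2 - y.2)), Real.sqrt_nonneg |x.2 - y.2|,
    abs_nonneg (x.1 - y.1)]

lemma pdist_pos {x y : ℝ × ℝ} (h : x ≠ y) : 0 < pdist x y := by
  refine lt_of_le_of_ne (pdist_nonneg x y) fun h0 => h ?_
  have h1 := abs_fst_sub_le_pdist x y
  have h2 := abs_snd_sub_le_pdist_sq x y
  rw [← h0] at h1 h2
  have e1 := abs_eq_zero.mp (le_antisymm h1 (abs_nonneg _))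
  have e2 : x.2 - y.2 = 0 := by simpa using h2
  exact Prod.ext (by linarith) (by linarith)

lemma pdist_sub_right (z y x : ℝ × ℝ) : pdist (z - y) x = pdist z (y + x) := by
  unfold pdist
  simp only [Prod.fst_sub, Prod.snd_sub, Prod.fst_add, Prod.snd_add, sub_sub]

lemma continuous_pdist_left (x : ℝ × ℝ) : Continuous fun y => pdist y x := by
  unfold pdist; fun_prop

lemma one_add_pdist_div_le (x y z : ℝ × ℝ) {r : ℝ} (hr : 0 < r) :
    1 + pdist x z / r ≤ (1 + pdist x y / r) * (1 + pdist y z / r) := by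
  have h := pdist_triangle x y z
  have h1 : pdist x z / r ≤ pdist x y / r + pdist y z / r := by
    rw [← add_div]; gcongr
  have h2 : 0 ≤ pdist x y / r * (pdist y z / r) :=
    mul_nonneg (div_nonneg (pdist_nonneg _ _) hr.le) (div_nonneg (pdist_nonneg _ _) hr.le)
  nlinarith

/-! ### The two-dimensional kernels -/

/-- The space-like profile. -/
def profX : 𝓢(ℝ, ℝ) := profile 2 one_le_two

/-- The time-like profile. -/
def profT : 𝓢(ℝ, ℝ) := profile 1 le_rfl

/-- The derivative `∂₁^i ∂₂^j` of the anisotropic kernel of scales `σ`, `τ`. -/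
def kern (i j : ℕ) (σ τ : ℝ) (w : ℝ × ℝ) : ℝ := qk profX i σ w.1 * qk profT j τ w.2

/-- Convolution with `kern`. -/
def Bop (i j : ℕ) (σ τ : ℝ) (u : ℝ × ℝ → ℝ) (z : ℝ × ℝ) : ℝ :=
  ∫ y, kern i j σ τ (z - y) * u y

/-- Bounded continuous functions. -/
def BddCont (u : ℝ × ℝ → ℝ) : Prop := Continuous u ∧ ∃ N, ∀ y, |u y| ≤ N

lemma BddCont.sub {u v : ℝ × ℝ → ℝ} (hu : BddCont u) (hv : BddCont v) :
    BddCont fun y => u y - v y := by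
  obtain ⟨hu, N, hN⟩ := hu
  obtain ⟨hv, N', hN'⟩ := hv
  exact ⟨hu.sub hv, N + N', fun y => (abs_sub _ _).trans (add_le_add (hN y) (hN' y))⟩

lemma BddCont.const_mul {u : ℝ × ℝ → ℝ} (hu : BddCont u) (c : ℝ) :
    BddCont fun y => c * u y := by
  obtain ⟨hu, N, hN⟩ := hu
  exact ⟨hu.const_mul c, |c| * N, fun y => by
    rw [abs_mul]; exact mul_le_mul_of_nonneg_left (hN y) (abs_nonneg c)⟩

lemma bddCont_const (c : ℝ) : BddCont fun _ => c :=
  ⟨continuous_const, |c|, fun _ => le_rfl⟩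

lemma continuous_kern (i j : ℕ) (σ τ : ℝ) : Continuous (kern i j σ τ) := by
  have h1 := continuous_qk profX i σ
  have h2 := continuous_qk profT j τ
  unfold kern
  fun_prop

lemma integrable_kern (i j : ℕ) {σ τ : ℝ} (hσ : 0 < σ) (hτ : 0 < τ) :
    Integrable (kern i j σ τ) :=
  (integrable_qk profX i σ hσ).mul_prod (integrable_qk profT j τ hτ)

lemma integral_kern (i j : ℕ) (σ τ : ℝ) :
    ∫ w, kern i j σ τ w = (∫ x, qk profX i σ x) * ∫ x, qk profT j τ x :=
  integral_prod_mul (qk profX i σ) (qk profT j τ)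

lemma integral_kern_zero {σ τ : ℝ} (hσ : 0 < σ) (hτ : 0 < τ) :
    ∫ w, kern 0 0 σ τ w = 1 := by
  rw [integral_kern, profX, profT, integral_qk_zero _ _ _ hσ, integral_qk_zero _ _ _ hτ, one_mul]

lemma integral_kern_pos (i j : ℕ) (hij : 1 ≤ i + j) {σ τ : ℝ} (hσ : 0 < σ) (hτ : 0 < τ) :
    ∫ w, kern i j σ τ w = 0 := by
  rw [integral_kern]
  rcases i with _ | i
  · rcases j with _ | j
    · simp at hij
    · rw [integral_qk_succ _ _ _ hτ, mul_zero]
  · rw [integral_qk_succ _ _ _ hσ, zero_mul]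

lemma Bop_eq (i j : ℕ) (σ τ : ℝ) (u : ℝ × ℝ → ℝ) (z : ℝ × ℝ) :
    Bop i j σ τ u z = ∫ w, kern i j σ τ w * u (z - w) := by
  rw [Bop, ← integral_sub_left_eq_self _ volume z]
  simp only [sub_sub_cancel]

lemma integrable_kern_mul (i j : ℕ) {σ τ : ℝ} (hσ : 0 < σ) (hτ : 0 < τ) {u : ℝ × ℝ → ℝ}
    (hu : BddCont u) (z : ℝ × ℝ) : Integrable fun y => kern i j σ τ (z - y) * u y := by
  obtain ⟨hu, N, hN⟩ := hu
  exact ((integrable_kern i j hσ hτ).comp_sub_left z).mul_bdd (c := N) hu.aestronglyMeasurable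
    (Filter.Eventually.of_forall hN)

lemma Bop_sub (i j : ℕ) {σ τ : ℝ} (hσ : 0 < σ) (hτ : 0 < τ) {u v : ℝ × ℝ → ℝ}
    (hu : BddCont u) (hv : BddCont v) (z : ℝ × ℝ) :
    Bop i j σ τ (fun y => u y - v y) z = Bop i j σ τ u z - Bop i j σ τ v z := by
  unfold Bop
  rw [← integral_sub (integrable_kern_mul i j hσ hτ hu z) (integrable_kern_mul i j hσ hτ hv z)]
  simp only [mul_sub]

lemma Bop_const_mul (i j : ℕ) (σ τ c : ℝ) (u : ℝ × ℝ → ℝ) (z : ℝ × ℝ) :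
    Bop i j σ τ (fun y => c * u y) z = c * Bop i j σ τ u z := by
  unfold Bop
  rw [← integral_const_mul]
  congr 1; ext y; ring

lemma Bop_const (i j : ℕ) (σ τ c : ℝ) (z : ℝ × ℝ) :
    Bop i j σ τ (fun _ => c) z = c * ∫ w, kern i j σ τ w := by
  rw [Bop_eq, integral_mul_const, mul_comm]

lemma Bop_sub_const (i j : ℕ) (hij : 1 ≤ i + j) {σ τ : ℝ} (hσ : 0 < σ) (hτ : 0 < τ)
    {u : ℝ × ℝ → ℝ} (hu : BddCont u) (c : ℝ) (z : ℝ × ℝ) :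
    Bop i j σ τ (fun y => u y - c) z = Bop i j σ τ u z := by
  rw [Bop_sub i j hσ hτ hu (bddCont_const c), Bop_const, integral_kern_pos i j hij hσ hτ]
  ring

lemma Bop_zero_sub_const {σ τ : ℝ} (hσ : 0 < σ) (hτ : 0 < τ)
    {u : ℝ × ℝ → ℝ} (hu : BddCont u) (c : ℝ) (z : ℝ × ℝ) :
    Bop 0 0 σ τ (fun y => u y - c) z = Bop 0 0 σ τ u z - c := by
  rw [Bop_sub 0 0 hσ hτ hu (bddCont_const c), Bop_const, integral_kern_zero hσ hτ, mul_one]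

lemma bddCont_Bop (i j : ℕ) {σ τ : ℝ} (hσ : 0 < σ) (hτ : 0 < τ) {u : ℝ × ℝ → ℝ}
    (hu : BddCont u) : BddCont (Bop i j σ τ u) := by
  obtain ⟨hu, N, hN⟩ := hu
  have hb : ∀ z w, ‖kern i j σ τ w * u (z - w)‖ ≤ ‖kern i j σ τ w‖ * N := fun z w => by
    rw [norm_mul]
    exact mul_le_mul_of_nonneg_left (hN _) (norm_nonneg _)
  have hk := continuous_kern i j σ τ
  have hi : Integrable fun w => ‖kern i j σ τ w‖ * N :=
    (integrable_kern i j hσ hτ).norm.mul_const N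
  rw [funext (Bop_eq i j σ τ u)]
  refine ⟨?_, ∫ w, ‖kern i j σ τ w‖ * N, fun z => ?_⟩
  · refine continuous_of_dominated (fun z => ?_) (fun z => Filter.Eventually.of_forall (hb z)) hi
      (Filter.Eventually.of_forall fun w => by fun_prop)
    exact (by fun_prop : Continuous fun w => kern i j σ τ w * u (z - w)).aestronglyMeasurable
  · exact norm_integral_le_of_norm_le hi (Filter.Eventually.of_forall (hb z))

lemma kern_le_of_near (i j : ℕ) {σ₀ τ₀ : ℝ} (hσ : 0 < σ₀) (hτ : 0 < τ₀) :
    ∃ C : ℝ, 0 < C ∧ ∀ σ ∈ Set.Icc (σ₀ / 2) (2 * σ₀), ∀ τ ∈ Set.Icc (τ₀ / 2) (2 * τ₀),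
      ∀ z z₀ y : ℝ × ℝ, |z.1 - z₀.1| ≤ 1 → |z.2 - z₀.2| ≤ 1 →
      |kern i j σ τ (z - y)| ≤ C * ((1 + (z₀.1 - y.1) ^ 2)⁻¹ * (1 + (z₀.2 - y.2) ^ 2)⁻¹) := by
  obtain ⟨C, hC0, hC⟩ := qk_le_of_near profX i σ₀ hσ
  obtain ⟨C', hC0', hC'⟩ := qk_le_of_near profT j τ₀ hτ
  refine ⟨C * C', by positivity, fun σ hs τ ht z z₀ y h1 h2 => ?_⟩
  rw [kern, abs_mul, mul_mul_mul_comm]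
  exact mul_le_mul (hC σ hs _ _ _ h1) (hC' τ ht _ _ _ h2) (abs_nonneg _) (by positivity)

lemma hasDerivAt_integral_mul {k k' : ℝ → ℝ × ℝ → ℝ} {p₀ : ℝ} {s : Set ℝ} (hs : s ∈ nhds p₀)
    (z : ℝ × ℝ) (C : ℝ) (hk : ∀ p, Continuous (k p)) (hk' : Continuous (k' p₀))
    (hInt : Integrable (k p₀))
    (hder : ∀ p ∈ s, ∀ y, HasDerivAt (fun p => k p y) (k' p y) p)
    (hb : ∀ p ∈ s, ∀ y, |k' p y| ≤ C * ((1 + (z.1 - y.1) ^ 2)⁻¹ * (1 + (z.2 - y.2) ^ 2)⁻¹))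
    {u : ℝ × ℝ → ℝ} (hu : BddCont u) :
    HasDerivAt (fun p => ∫ y, k p y * u y) (∫ y, k' p₀ y * u y) p₀ := by
  obtain ⟨hu, N, hN⟩ := hu
  have hbi : Integrable fun y : ℝ × ℝ =>
      C * ((1 + (z.1 - y.1) ^ 2)⁻¹ * (1 + (z.2 - y.2) ^ 2)⁻¹) * N :=
    (((integrable_inv_one_add_sub_sq z.1).mul_prod
      (integrable_inv_one_add_sub_sq z.2)).const_mul C).mul_const N
  refine (hasDerivAt_integral_of_dominated_loc_of_deriv_le (μ := volume)
    (F := fun p y => k p y * u y) (F' := fun p y => k' p y * u y) hs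
    (Filter.Eventually.of_forall fun p => ((hk p).mul hu).aestronglyMeasurable)
    (hInt.mul_bdd (c := N) hu.aestronglyMeasurable (Filter.Eventually.of_forall hN))
    (hk'.mul hu).aestronglyMeasurable
    (Filter.Eventually.of_forall fun y p hp => ?_) hbi
    (Filter.Eventually.of_forall fun y p hp => (hder p hp y).mul_const _)).2
  rw [norm_mul]
  exact mul_le_mul (hb p hp y) (hN y) (norm_nonneg _) ((abs_nonneg _).trans (hb p hp y))

lemma hasDerivAt_Bop_fst (i j : ℕ) {σ τ : ℝ} (hσ : 0 < σ) (hτ : 0 < τ) {u : ℝ × ℝ → ℝ}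
    (hu : BddCont u) (s t : ℝ) :
    HasDerivAt (fun s => Bop i j σ τ u (s, t)) (Bop (i + 1) j σ τ u (s, t)) s := by
  obtain ⟨C, hC0, hC⟩ := kern_le_of_near (i + 1) j hσ hτ
  have hk := continuous_kern i j σ τ
  have hk' := continuous_kern (i + 1) j σ τ
  refine hasDerivAt_integral_mul (k := fun s y => kern i j σ τ ((s, t) - y))
    (k' := fun s y => kern (i + 1) j σ τ ((s, t) - y)) (Metric.closedBall_mem_nhds s one_pos)
    (s, t) C (fun p => by fun_prop) (by fun_prop) ((integrable_kern i j hσ hτ).comp_sub_left _)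
    (fun p _ y => ?_) (fun p hp y => ?_) hu
  · have h1 : HasDerivAt (fun p : ℝ => p - y.1) 1 p := (hasDerivAt_id p).sub_const y.1
    have h2 := ((hasDerivAt_qk profX i σ (p - y.1)).comp p h1).mul_const (qk profT j τ (t - y.2))
    rw [mul_one] at h2
    exact h2
  · exact hC σ ⟨by linarith, by linarith⟩ τ ⟨by linarith, by linarith⟩ (p, t) (s, t) y
      (by simpa [Real.dist_eq] using hp) (by simp)

lemma hasDerivAt_Bop_snd (i j : ℕ) {σ τ : ℝ} (hσ : 0 < σ) (hτ : 0 < τ) {u : ℝ × ℝ → ℝ}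
    (hu : BddCont u) (s t : ℝ) :
    HasDerivAt (fun t => Bop i j σ τ u (s, t)) (Bop i (j + 1) σ τ u (s, t)) t := by
  obtain ⟨C, hC0, hC⟩ := kern_le_of_near i (j + 1) hσ hτ
  have hk := continuous_kern i j σ τ
  have hk' := continuous_kern i (j + 1) σ τ
  refine hasDerivAt_integral_mul (k := fun t y => kern i j σ τ ((s, t) - y))
    (k' := fun t y => kern i (j + 1) σ τ ((s, t) - y)) (Metric.closedBall_mem_nhds t one_pos)
    (s, t) C (fun p => by fun_prop) (by fun_prop) ((integrable_kern i j hσ hτ).comp_sub_left _)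
    (fun p _ y => ?_) (fun p hp y => ?_) hu
  · have h1 : HasDerivAt (fun p : ℝ => p - y.2) 1 p := (hasDerivAt_id p).sub_const y.2
    have h2 := ((hasDerivAt_qk profT j τ (p - y.2)).comp p h1).const_mul (qk profX i σ (s - y.1))
    rw [mul_one] at h2
    exact h2
  · exact hC σ ⟨by linarith, by linarith⟩ τ ⟨by linarith, by linarith⟩ (s, p) (s, t) y
      (by simp) (by simpa [Real.dist_eq] using hp)

lemma hasDerivAt_Bop_scale (i j : ℕ) {A B : ℝ} (hA : 0 < A) (hB : 0 < B) {u : ℝ × ℝ → ℝ}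
    (hu : BddCont u) (z : ℝ × ℝ) {r : ℝ} (hr : 0 < r) :
    HasDerivAt (fun r => Bop i j (A * r) (B * r ^ 2) u z)
      (r ^ 3 * (-(odeConst 2 * A ^ 4) * Bop (i + 4) j (A * r) (B * r ^ 2) u z -
        2 * odeConst 1 * B ^ 2 * Bop i (j + 2) (A * r) (B * r ^ 2) u z)) r := by
  have hσ : 0 < A * r := by positivity
  have hτ : 0 < B * r ^ 2 := by positivity
  obtain ⟨C, hC0, hC⟩ := kern_le_of_near (i + 4) j hσ hτ
  obtain ⟨C', hC0', hC'⟩ := kern_le_of_near i (j + 2) hσ hτ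
  set c₁ := |odeConst 2 * A ^ 4| with hc1
  set c₂ := |2 * odeConst 1 * B ^ 2| with hc2
  have hs : Set.Icc (r * (3 / 4)) (r * (5 / 4)) ∈ nhds r :=
    Icc_mem_nhds (by linarith) (by linarith)
  have hk : ∀ i j σ τ, Continuous (kern i j σ τ) := continuous_kern
  have key := hasDerivAt_integral_mul (p₀ := r)
    (k := fun r y => kern i j (A * r) (B * r ^ 2) (z - y))
    (k' := fun r y => r ^ 3 * (-(odeConst 2 * A ^ 4) * kern (i + 4) j (A * r) (B * r ^ 2) (z - y) -
        2 * odeConst 1 * B ^ 2 * kern i (j + 2) (A * r) (B * r ^ 2) (z - y))) hs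
    z ((2 * r) ^ 3 * (c₁ * C + c₂ * C')) (fun p => by have := hk i j; fun_prop)
    (by have := hk (i + 4) j; have := hk i (j + 2); fun_prop)
    ((integrable_kern i j hσ hτ).comp_sub_left _)
    (fun p hp y => ?_) (fun p hp y => ?_) hu
  · refine key.congr_deriv ?_
    have h1 := integrable_kern_mul (i + 4) j hσ hτ hu z
    have h2 := integrable_kern_mul i (j + 2) hσ hτ hu z
    unfold Bop
    rw [← integral_const_mul, ← integral_const_mul, ← integral_sub (h1.const_mul _) (h2.const_mul _),
      ← integral_const_mul]
    congr 1; ext y; ring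
  · have hp0 : 0 < p := by linarith [hp.1]
    have h1 : HasDerivAt (fun p : ℝ => A * p) A p := by
      simpa using (hasDerivAt_id p).const_mul A
    have h2 : HasDerivAt (fun p : ℝ => B * p ^ 2) (B * (2 * p)) p := by
      simpa using (hasDerivAt_pow 2 p).const_mul B
    have h3 := HasDerivAt.comp (h₂ := fun σ => qk profX i σ (z - y).1) (h := fun p => A * p) p
      (hasDerivAt_qk_scale 2 one_le_two i (A * p) (by positivity) (z - y).1) h1
    have h4 := HasDerivAt.comp (h₂ := fun σ => qk profT j σ (z - y).2) (h := fun p => B * p ^ 2) p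
      (hasDerivAt_qk_scale 1 le_rfl j (B * p ^ 2) (by positivity) (z - y).2) h2
    refine (h3.mul h4).congr_deriv ?_
    simp only [kern, Function.comp, profX, profT]
    norm_num
    ring
  · have hp0 : 0 < p := by linarith [hp.1]
    have e1 : A * p ∈ Set.Icc (A * r / 2) (2 * (A * r)) :=
      ⟨by nlinarith [hp.1], by nlinarith [hp.2]⟩
    have e2 : B * p ^ 2 ∈ Set.Icc (B * r ^ 2 / 2) (2 * (B * r ^ 2)) := by
      constructor
      · have : r ^ 2 / 2 ≤ p ^ 2 := by nlinarith [hp.1]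
        nlinarith
      · have : p ^ 2 ≤ 2 * r ^ 2 := by nlinarith [hp.2]
        nlinarith
    have b1 := hC _ e1 _ e2 z z y (by simp) (by simp)
    have b2 := hC' _ e1 _ e2 z z y (by simp) (by simp)
    have hpr : p ^ 3 ≤ (2 * r) ^ 3 := by
      gcongr; linarith [hp.2]
    rw [abs_mul, abs_of_pos (by positivity : 0 < p ^ 3)]
    have : |-(odeConst 2 * A ^ 4) * kern (i + 4) j (A * p) (B * p ^ 2) (z - y) -
        2 * odeConst 1 * B ^ 2 * kern i (j + 2) (A * p) (B * p ^ 2) (z - y)| ≤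
        c₁ * (C * ((1 + (z.1 - y.1) ^ 2)⁻¹ * (1 + (z.2 - y.2) ^ 2)⁻¹)) +
        c₂ * (C' * ((1 + (z.1 - y.1) ^ 2)⁻¹ * (1 + (z.2 - y.2) ^ 2)⁻¹)) := by
      refine (abs_sub _ _).trans ?_
      rw [abs_mul, abs_mul, abs_neg]
      gcongr
    calc _ ≤ (2 * r) ^ 3 * (c₁ * (C * ((1 + (z.1 - y.1) ^ 2)⁻¹ * (1 + (z.2 - y.2) ^ 2)⁻¹)) +
        c₂ * (C' * ((1 + (z.1 - y.1) ^ 2)⁻¹ * (1 + (z.2 - y.2) ^ 2)⁻¹))) :=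
          mul_le_mul hpr this (abs_nonneg _) (by positivity)
      _ = _ := by ring

lemma kern_conv (i j i' j' : ℕ) {σ τ σ' τ' ρ θ : ℝ} (hσ : 0 < σ) (hτ : 0 < τ) (hσ' : 0 < σ')
    (hτ' : 0 < τ') (hρ : 0 < ρ) (hθ : 0 < θ) (h1 : ρ ^ 4 = σ ^ 4 + σ' ^ 4)
    (h2 : θ ^ 2 = τ ^ 2 + τ' ^ 2) (z : ℝ × ℝ) :
    ∫ w, kern i j σ τ w * kern i' j' σ' τ' (z - w) = kern (i + i') (j + j') ρ θ z := by
  have e1 := qk_conv 2 one_le_two i' i σ' σ ρ hσ' hσ hρ (by norm_num; linarith) z.1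
  have e2 := qk_conv 1 le_rfl j' j τ' τ θ hτ' hτ hθ (by norm_num; linarith) z.2
  rw [kern, profX, profT, add_comm i i', add_comm j j', ← e1, ← e2, ← integral_prod_mul]
  congr 1
  ext w
  simp only [kern, profX, profT, Prod.fst_sub, Prod.snd_sub]
  ring

lemma Bop_Bop (i j i' j' : ℕ) {σ τ σ' τ' ρ θ : ℝ} (hσ : 0 < σ) (hτ : 0 < τ) (hσ' : 0 < σ')
    (hτ' : 0 < τ') (hρ : 0 < ρ) (hθ : 0 < θ) (h1 : ρ ^ 4 = σ ^ 4 + σ' ^ 4)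
    (h2 : θ ^ 2 = τ ^ 2 + τ' ^ 2) {u : ℝ × ℝ → ℝ} (hu : BddCont u) (z : ℝ × ℝ) :
    Bop i j σ τ (Bop i' j' σ' τ' u) z = Bop (i + i') (j + j') ρ θ u z := by
  have hk := continuous_kern i j σ τ
  have hk' := continuous_kern i' j' σ' τ'
  have hi := integrable_kern i j hσ hτ
  have hi' := integrable_kern i' j' hσ' hτ'
  have hInt : Integrable (Function.uncurry fun w v : ℝ × ℝ =>
      kern i j σ τ w * kern i' j' σ' τ' (z - w - v)) (volume.prod volume) := by
    rw [integrable_prod_iff (by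
      exact (by fun_prop : Continuous (Function.uncurry fun w v : ℝ × ℝ =>
        kern i j σ τ w * kern i' j' σ' τ' (z - w - v))).aestronglyMeasurable)]
    refine ⟨Filter.Eventually.of_forall fun w => ?_, ?_⟩
    · exact (hi'.comp_sub_left (z - w)).const_mul (kern i j σ τ w)
    simp only [Function.uncurry_apply_pair, norm_mul, integral_const_mul]
    simp only [fun w => integral_sub_left_eq_self (fun v => ‖kern i' j' σ' τ' v‖) volume (z - w)]
    exact hi.norm.mul_const _
  obtain ⟨huc, N, hN⟩ := hu
  have hInt2 : Integrable (Function.uncurry fun w v : ℝ × ℝ =>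
      kern i j σ τ w * kern i' j' σ' τ' (z - w - v) * u v) (volume.prod volume) := by
    refine hInt.mul_bdd (c := N) (g := fun p : (ℝ × ℝ) × (ℝ × ℝ) => u p.2) ?_ ?_
    · exact (by fun_prop : Continuous fun p : (ℝ × ℝ) × (ℝ × ℝ) => u p.2).aestronglyMeasurable
    · exact Filter.Eventually.of_forall fun p => hN _
  rw [Bop_eq]
  simp only [Bop, ← integral_const_mul, ← mul_assoc]
  rw [integral_integral_swap hInt2]
  congr 1
  ext v
  rw [integral_mul_const, ← kern_conv i j i' j' hσ hτ hσ' hτ' hρ hθ h1 h2]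
  congr 2
  ext w
  rw [sub_right_comm]

/-! ### Quantitative bounds -/

lemma kern_weight (i j n : ℕ) (m M : ℝ) (hm : 0 < m) :
    ∃ C : ℝ, 0 < C ∧ ∀ A ∈ Set.Icc m M, ∀ B ∈ Set.Icc m M, ∀ r : ℝ, 0 < r →
      Integrable (fun w => |kern i j (A * r) (B * r ^ 2) w| * (1 + pdist w 0 / r) ^ n) ∧
      ∫ w, |kern i j (A * r) (B * r ^ 2) w| * (1 + pdist w 0 / r) ^ n ≤ C * (r⁻¹) ^ (i + 2 * j) := by
  obtain ⟨C, hC0, hC⟩ := qk_weight profX i n m M hm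
  obtain ⟨C', hC0', hC'⟩ := qk_weight profT j n m M hm
  refine ⟨2 ^ n * C * C', by positivity, fun A hA B hB r hr => ?_⟩
  obtain ⟨i1, b1⟩ := hC A hA r hr
  obtain ⟨i2, b2⟩ := hC' B hB (r ^ 2) (by positivity)
  have hi := (i1.mul_prod i2).const_mul (2 ^ n)
  have hle : ∀ w : ℝ × ℝ, |kern i j (A * r) (B * r ^ 2) w| * (1 + pdist w 0 / r) ^ n ≤
      2 ^ n * (|qk profX i (A * r) w.1| * (1 + |w.1| / r) ^ n *
        (|qk profT j (B * r ^ 2) w.2| * (1 + |w.2| / r ^ 2) ^ n)) := by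
    intro w
    have e1 : 1 + pdist w 0 / r ≤ 2 * ((1 + |w.1| / r) * (1 + |w.2| / r ^ 2)) := by
      have hs : √|w.2| / r ≤ 1 + |w.2| / r ^ 2 := by
        have : √|w.2| / r = √(|w.2| / r ^ 2) := by
          rw [Real.sqrt_div (abs_nonneg _), Real.sqrt_sq hr.le]
        rw [this, Real.sqrt_le_left (by positivity)]
        have : 0 ≤ |w.2| / r ^ 2 := by positivity
        nlinarith
      have h0 : pdist w 0 / r = |w.1| / r + √|w.2| / r := by
        simp [pdist, add_div]
      have a1 : 0 ≤ |w.1| / r := by positivity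
      have a2 : 0 ≤ |w.2| / r ^ 2 := by positivity
      rw [h0]
      nlinarith [mul_nonneg a1 a2]
    rw [kern, abs_mul]
    have h0 : 0 ≤ 1 + pdist w 0 / r := by
      have := pdist_nonneg w 0
      positivity
    calc |qk profX i (A * r) w.1| * |qk profT j (B * r ^ 2) w.2| * (1 + pdist w 0 / r) ^ n
        ≤ |qk profX i (A * r) w.1| * |qk profT j (B * r ^ 2) w.2| *
          (2 * ((1 + |w.1| / r) * (1 + |w.2| / r ^ 2))) ^ n := by gcongr
      _ = _ := by rw [mul_pow, mul_pow]; ring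
  have hI : Integrable (fun w => |kern i j (A * r) (B * r ^ 2) w| * (1 + pdist w 0 / r) ^ n) := by
    have hk := continuous_kern i j (A * r) (B * r ^ 2)
    have hp := continuous_pdist_left 0
    refine hi.mono' (by
      exact (by fun_prop : Continuous fun w => |kern i j (A * r) (B * r ^ 2) w| *
        (1 + pdist w 0 / r) ^ n).aestronglyMeasurable) (Filter.Eventually.of_forall fun w => ?_)
    rw [Real.norm_eq_abs, abs_of_nonneg]
    · exact hle w
    · have := pdist_nonneg w 0
      positivity
  refine ⟨hI, ?_⟩
  refine (integral_mono hI hi hle).trans ?_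
  rw [integral_const_mul]
  have hp := integral_prod_mul (μ := (volume : Measure ℝ)) (ν := (volume : Measure ℝ))
    (fun x => |qk profX i (A * r) x| * (1 + |x| / r) ^ n)
    (fun x => |qk profT j (B * r ^ 2) x| * (1 + |x| / r ^ 2) ^ n)
  rw [← Measure.volume_eq_prod] at hp
  rw [hp]
  have n2 : 0 ≤ ∫ x, |qk profT j (B * r ^ 2) x| * (1 + |x| / r ^ 2) ^ n :=
    integral_nonneg fun x => by positivity
  calc _ ≤ 2 ^ n * ((C * (r⁻¹) ^ i) * (C' * ((r ^ 2)⁻¹) ^ j)) := by gcongr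
    _ = _ := by rw [pow_add, pow_mul, inv_pow r 2]; ring

lemma Bop_growth (i j n : ℕ) (m M : ℝ) (hm : 0 < m) :
    ∃ C : ℝ, 0 < C ∧ ∀ A ∈ Set.Icc m M, ∀ B ∈ Set.Icc m M, ∀ r : ℝ, 0 < r →
      ∀ (u : ℝ × ℝ → ℝ) (x z : ℝ × ℝ) (N : ℝ), Continuous u →
      (∀ y, |u y| ≤ N * (1 + pdist y x / r) ^ n) →
      Integrable (fun y => kern i j (A * r) (B * r ^ 2) (z - y) * u y) ∧
      |Bop i j (A * r) (B * r ^ 2) u z| ≤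
        C * (r⁻¹) ^ (i + 2 * j) * N * (1 + pdist z x / r) ^ n := by
  obtain ⟨C, hC0, hC⟩ := kern_weight i j n m M hm
  refine ⟨C, hC0, fun A hA B hB r hr u x z N hu hN => ?_⟩
  obtain ⟨hi, hb⟩ := hC A hA B hB r hr
  have hN0 : 0 ≤ N := by
    have := (abs_nonneg _).trans (hN x)
    rw [pdist_self, zero_div, add_zero, one_pow, mul_one] at this
    exact this
  have hi2 := (hi.comp_sub_left z).mul_const (N * (1 + pdist z x / r) ^ n)
  have hle : ∀ y, ‖kern i j (A * r) (B * r ^ 2) (z - y) * u y‖ ≤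
      |kern i j (A * r) (B * r ^ 2) (z - y)| * (1 + pdist (z - y) 0 / r) ^ n *
        (N * (1 + pdist z x / r) ^ n) := by
    intro y
    have h1 := one_add_pdist_div_le y z x hr
    have h2 : pdist (z - y) 0 = pdist y z := by
      rw [pdist_sub_right, add_zero, pdist_comm]
    have p1 := pdist_nonneg y x
    have p2 := pdist_nonneg y z
    have p3 := pdist_nonneg z x
    rw [norm_mul, Real.norm_eq_abs, Real.norm_eq_abs, h2]
    calc _ ≤ |kern i j (A * r) (B * r ^ 2) (z - y)| * (N * ((1 + pdist y z / r) *
        (1 + pdist z x / r)) ^ n) := by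
          gcongr
          refine (hN y).trans ?_
          gcongr
      _ = _ := by rw [mul_pow]; ring
  have hk := continuous_kern i j (A * r) (B * r ^ 2)
  refine ⟨hi2.mono' (by
    exact (by fun_prop : Continuous fun y => kern i j (A * r) (B * r ^ 2) (z - y) *
      u y).aestronglyMeasurable) (Filter.Eventually.of_forall hle), ?_⟩
  refine (norm_integral_le_of_norm_le hi2 (Filter.Eventually.of_forall hle)).trans ?_
  rw [integral_mul_const, integral_sub_left_eq_self
    (fun w => |kern i j (A * r) (B * r ^ 2) w| * (1 + pdist w 0 / r) ^ n) volume z]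
  have p3 := pdist_nonneg z x
  calc _ ≤ C * (r⁻¹) ^ (i + 2 * j) * (N * (1 + pdist z x / r) ^ n) := by gcongr
    _ = _ := by ring

lemma Bop_fst_sub {A B r : ℝ} (hA : 0 < A) (hB : 0 < B) (hr : 0 < r) (z : ℝ × ℝ) :
    Integrable (fun y => kern 0 0 (A * r) (B * r ^ 2) (z - y) * (y.1 - z.1)) ∧
    Bop 0 0 (A * r) (B * r ^ 2) (fun y => y.1 - z.1) z = 0 := by
  constructor
  · obtain ⟨C, -, hC⟩ := Bop_growth 0 0 1 (min A B) (max A B) (lt_min hA hB)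
    refine (hC A (by simp) B (by simp) r hr (fun y => y.1 - z.1) z z r (by fun_prop)
      fun y => ?_).1
    have := abs_fst_sub_le_pdist y z
    rw [pow_one, mul_add, mul_div_cancel₀ _ hr.ne']
    linarith
  · rw [Bop_eq]
    have h := integral_prod_mul (μ := (volume : Measure ℝ)) (ν := (volume : Measure ℝ))
      (fun x => x * qk profX 0 (A * r) x) (qk profT 0 (B * r ^ 2))
    rw [← Measure.volume_eq_prod, profX, integral_id_mul_qk, zero_mul] at h
    rw [← neg_eq_zero, ← integral_neg, ← h]
    congr 1
    ext w
    simp only [kern, Prod.fst_sub, profX]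
    ring

lemma Bop_sub_affine {A B r : ℝ} (hA : 0 < A) (hB : 0 < B) (hr : 0 < r) {u : ℝ × ℝ → ℝ}
    (hu : BddCont u) (c ν b : ℝ) (z : ℝ × ℝ) :
    Bop 0 0 (A * r) (B * r ^ 2) (fun y => u y - c - ν * (y.1 - b)) z =
      Bop 0 0 (A * r) (B * r ^ 2) u z - c - ν * (z.1 - b) := by
  have hσ : 0 < A * r := by positivity
  have hτ : 0 < B * r ^ 2 := by positivity
  obtain ⟨h1, h2⟩ := Bop_fst_sub hA hB hr z
  have h3 := Bop_zero_sub_const hσ hτ hu (c + ν * (z.1 - b)) z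
  have h4 := integrable_kern_mul 0 0 hσ hτ (hu.sub (bddCont_const (c + ν * (z.1 - b)))) z
  have h5 : Bop 0 0 (A * r) (B * r ^ 2) (fun y => u y - c - ν * (y.1 - b)) z =
      Bop 0 0 (A * r) (B * r ^ 2) (fun y => u y - (c + ν * (z.1 - b))) z -
      ν * Bop 0 0 (A * r) (B * r ^ 2) (fun y => y.1 - z.1) z := by
    unfold Bop
    rw [← integral_const_mul, ← integral_sub h4 (h1.const_mul _)]
    congr 1
    ext y
    ring
  rw [h5, h3, h2]
  ring

lemma tendsto_Bop_zero {A B : ℝ} (hA : 0 < A) (hB : 0 < B) {u : ℝ × ℝ → ℝ} (hu : BddCont u)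
    (x : ℝ × ℝ) :
    Filter.Tendsto (fun r => Bop 0 0 (A * r) (B * r ^ 2) u x) (nhdsWithin 0 (Set.Ioi 0))
      (nhds (u x)) := by
  obtain ⟨C, hC0, hC⟩ := Bop_growth 0 0 1 (min A B) (max A B) (lt_min hA hB)
  obtain ⟨huc, N, hN⟩ := id hu
  rw [Metric.tendsto_nhdsWithin_nhds]
  intro ε hε
  set δ := ε / (4 * C) with hδ
  have hδ0 : 0 < δ := by positivity
  obtain ⟨η, hη, hη2⟩ := Metric.continuous_iff.mp huc x δ hδ0
  set ρ := min (η / 2) (√(η / 2)) with hρ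
  have hρ0 : 0 < ρ := lt_min (by positivity) (Real.sqrt_pos.mpr (by positivity))
  have hnear : ∀ y, pdist y x ≤ ρ → |u y - u x| ≤ δ := by
    intro y hy
    refine (hη2 y ?_).le
    have h1 := (abs_fst_sub_le_pdist y x).trans (hy.trans (min_le_left _ _))
    have h2 : |y.2 - x.2| ≤ η / 2 := by
      refine (abs_snd_sub_le_pdist_sq y x).trans ?_
      calc pdist y x ^ 2 ≤ (√(η / 2)) ^ 2 :=
            pow_le_pow_left₀ (pdist_nonneg _ _) (hy.trans (min_le_right _ _)) 2
        _ = η / 2 := Real.sq_sqrt (by positivity)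
    rw [Prod.dist_eq, Real.dist_eq, Real.dist_eq]
    exact max_lt (by linarith) (by linarith)
  have hN0 : 0 ≤ N := (abs_nonneg _).trans (hN x)
  refine ⟨ρ * δ / (2 * N + 1), by positivity, fun {r} hr hr2 => ?_⟩
  rw [Set.mem_Ioi] at hr
  rw [Real.dist_eq, sub_zero, abs_of_pos hr, lt_div_iff₀ (by positivity)] at hr2
  rw [Real.dist_eq, ← Bop_zero_sub_const (by positivity) (by positivity) hu]
  have hg : ∀ y, |u y - u x| ≤ 2 * δ * (1 + pdist y x / r) ^ 1 := by
    intro y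
    have hp := pdist_nonneg y x
    have hpr : 0 ≤ pdist y x / r := by positivity
    rw [pow_one]
    rcases le_total (pdist y x) ρ with h | h
    · have := hnear y h
      nlinarith
    · have h1 : |u y - u x| ≤ 2 * N := by
        have := abs_sub (u y) (u x)
        linarith [hN y, hN x]
      have h2 : 2 * N ≤ δ * (pdist y x / r) := by
        rw [← mul_div_assoc, le_div_iff₀ hr]
        nlinarith
      nlinarith
  have := (hC A (by simp) B (by simp) r hr (fun y => u y - u x) x x (2 * δ)
    (by fun_prop) hg).2
  refine this.trans_lt ?_
  rw [pdist_self]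
  simp only [mul_zero, add_zero, pow_zero, mul_one, zero_div, one_pow, hδ]
  field_simp
  norm_num

lemma rpow_le_growth {r d p : ℝ} (hr : 0 < r) (hd : 0 ≤ d) (hp : 0 ≤ p) (hp2 : p ≤ 2) :
    d ^ p ≤ r ^ p * (1 + d / r) ^ 2 := by
  have h1 : d = r * (d / r) := by field_simp
  have h2 : 0 ≤ d / r := by positivity
  conv_lhs => rw [h1]
  rw [Real.mul_rpow hr.le h2]
  gcongr
  calc (d / r) ^ p ≤ (1 + d / r) ^ p := Real.rpow_le_rpow h2 (by linarith) hp
    _ ≤ (1 + d / r) ^ (2 : ℝ) := Real.rpow_le_rpow_of_exponent_le (by linarith) hp2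
    _ = _ := by norm_num

/-! ### Identification of the mollifier -/

lemma psiK_eq {r : ℝ} (hr : 0 < r) (x : ℝ × ℝ) : psiK (r ^ 4) x = kern 0 0 r (r ^ 2) x := by
  have hr2 : 0 < r ^ 2 := by positivity
  have c1 := integrable_exp_mul_cos 2 one_le_two r hr.ne' x.1
  have c2 := integrable_exp_mul_cos 1 le_rfl (r ^ 2) hr2.ne' x.2
  have s1 := integrable_exp_mul_sin 2 one_le_two r hr.ne' x.1
  have s2 := integrable_exp_mul_sin 1 le_rfl (r ^ 2) hr2.ne' x.2
  have z1 := integral_exp_mul_sin 2 r x.1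
  have hp : ∀ k : ℝ × ℝ, Real.exp (-(r ^ 4 * (k.1 ^ 4 + k.2 ^ 2))) *
      Real.cos (2 * Real.pi * (k.1 * x.1 + k.2 * x.2)) =
      (Real.exp (-(r * k.1) ^ (2 * 2)) * Real.cos (2 * Real.pi * (k.1 * x.1))) *
        (Real.exp (-(r ^ 2 * k.2) ^ (2 * 1)) * Real.cos (2 * Real.pi * (k.2 * x.2))) -
      (Real.exp (-(r * k.1) ^ (2 * 2)) * Real.sin (2 * Real.pi * (k.1 * x.1))) *
        (Real.exp (-(r ^ 2 * k.2) ^ (2 * 1)) * Real.sin (2 * Real.pi * (k.2 * x.2))) := by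
    intro k
    rw [mul_add (2 * Real.pi), Real.cos_add, show -(r ^ 4 * (k.1 ^ 4 + k.2 ^ 2)) =
      -(r * k.1) ^ (2 * 2) + -(r ^ 2 * k.2) ^ (2 * 1) by ring, Real.exp_add]
    ring
  rw [psiK]
  simp only [hp]
  rw [Measure.volume_eq_prod, integral_sub (c1.mul_prod c2) (s1.mul_prod s2)]
  have e1 := integral_prod_mul (μ := (volume : Measure ℝ)) (ν := (volume : Measure ℝ))
    (fun k : ℝ => Real.exp (-(r * k) ^ (2 * 2)) * Real.cos (2 * Real.pi * (k * x.1)))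
    (fun k : ℝ => Real.exp (-(r ^ 2 * k) ^ (2 * 1)) * Real.cos (2 * Real.pi * (k * x.2)))
  have e2 := integral_prod_mul (μ := (volume : Measure ℝ)) (ν := (volume : Measure ℝ))
    (fun k : ℝ => Real.exp (-(r * k) ^ (2 * 2)) * Real.sin (2 * Real.pi * (k * x.1)))
    (fun k : ℝ => Real.exp (-(r ^ 2 * k) ^ (2 * 1)) * Real.sin (2 * Real.pi * (k * x.2)))
  rw [e1, e2, z1, zero_mul, sub_zero, kern, profX, profT, qk_profile _ _ _ hr,
    qk_profile _ _ _ hr2]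

lemma mollS_eq {r : ℝ} (hr : 0 < r) (u : ℝ × ℝ → ℝ) :
    mollS (r ^ 4) u = Bop 0 0 r (r ^ 2) u := by
  ext x
  simp only [mollS, Bop, psiK_eq hr]

lemma pd1_Bop (i j : ℕ) {σ τ : ℝ} (hσ : 0 < σ) (hτ : 0 < τ) {u : ℝ × ℝ → ℝ} (hu : BddCont u) :
    pd1 (Bop i j σ τ u) = Bop (i + 1) j σ τ u := by
  ext x
  exact (hasDerivAt_Bop_fst i j hσ hτ hu x.1 x.2).deriv

lemma pd2_Bop (i j : ℕ) {σ τ : ℝ} (hσ : 0 < σ) (hτ : 0 < τ) {u : ℝ × ℝ → ℝ} (hu : BddCont u) :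
    pd2 (Bop i j σ τ u) = Bop i (j + 1) σ τ u := by
  ext x
  exact (hasDerivAt_Bop_snd i j hσ hτ hu x.1 x.2).deriv

/-! ### Oscillation of periodic functions almost solving a parabolic equation -/

lemma PeriodicFn.add_fst {w : ℝ × ℝ → ℝ} (hw : PeriodicFn w) (s t : ℝ) (k : ℤ) :
    w (s + k, t) = w (s, t) := by
  simpa using hw (s, t) (k, 0)

lemma PeriodicFn.add_snd {w : ℝ × ℝ → ℝ} (hw : PeriodicFn w) (s t : ℝ) (k : ℤ) :
    w (s, t + k) = w (s, t) := by
  simpa using hw (s, t) (0, k)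

lemma PeriodicFn.fract_fst {w : ℝ × ℝ → ℝ} (hw : PeriodicFn w) (s t : ℝ) :
    w (Int.fract s, t) = w (s, t) := by
  rw [← PeriodicFn.add_fst hw (Int.fract s) t ⌊s⌋, Int.fract_add_floor]

lemma PeriodicFn.fract_snd {w : ℝ × ℝ → ℝ} (hw : PeriodicFn w) (s t : ℝ) :
    w (s, Int.fract t) = w (s, t) := by
  rw [← PeriodicFn.add_snd hw s (Int.fract t) ⌊t⌋, Int.fract_add_floor]

lemma fract_mem_Icc (s : ℝ) : Int.fract s ∈ Set.Icc (0 : ℝ) 1 :=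
  ⟨Int.fract_nonneg s, (Int.fract_lt_one s).le⟩

lemma PeriodicFn.bounded {w : ℝ × ℝ → ℝ} (hw : PeriodicFn w) (hc : Continuous w) :
    ∃ N, ∀ z, |w z| ≤ N := by
  have hK : IsCompact (Set.Icc (0 : ℝ) 1 ×ˢ Set.Icc (0 : ℝ) 1) := isCompact_Icc.prod isCompact_Icc
  obtain ⟨N, hN⟩ := hK.exists_bound_of_continuousOn hc.continuousOn
  refine ⟨N, fun z => ?_⟩
  rw [show w z = w (Int.fract z.1, Int.fract z.2) by
    rw [PeriodicFn.fract_fst hw, PeriodicFn.fract_snd hw]]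
  exact hN _ ⟨fract_mem_Icc _, fract_mem_Icc _⟩

lemma second_deriv_nonpos {f f' : ℝ → ℝ} {f'' x : ℝ} (hmax : IsLocalMax f x)
    (h1 : ∀ y, HasDerivAt f (f' y) y) (h2 : HasDerivAt f' f'' x) : f'' ≤ 0 := by
  by_contra! hpos
  have hd : deriv f = f' := funext fun y => (h1 y).deriv
  have hdd : deriv (deriv f) x = f'' := by rw [hd, h2.deriv]
  have hmin : IsLocalMin f x := isLocalMin_of_deriv_deriv_pos (by rw [hdd]; exact hpos)
    hmax.deriv_eq_zero (h1 x).continuousAt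
  have hconst : f =ᶠ[nhds x] fun _ => f x := by
    filter_upwards [hmax, hmin] with y hy hy' using le_antisymm hy hy'
  have h3 := hconst.deriv.deriv_eq
  rw [hdd] at h3
  simp at h3
  exact hpos.ne' h3

/-- Regularity of a periodic function with derivatives `w1 = ∂₁w`, `w11 = ∂₁²w`, `w2 = ∂₂w`. -/
structure PeriodicC2 (w w1 w11 w2 : ℝ × ℝ → ℝ) : Prop where
  per : PeriodicFn w
  cont : Continuous w
  cont11 : Continuous w11
  cont2 : Continuous w2
  d1 : ∀ s t, HasDerivAt (fun s => w (s, t)) (w1 (s, t)) s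
  d11 : ∀ s t, HasDerivAt (fun s => w1 (s, t)) (w11 (s, t)) s
  d2 : ∀ s t, HasDerivAt (fun t => w (s, t)) (w2 (s, t)) t

section

variable {w w1 w11 w2 : ℝ × ℝ → ℝ} {lam g : ℝ}

lemma PeriodicC2.slice_increment (h : PeriodicC2 w w1 w11 w2) (hlam : 0 < lam) (hg : 0 < g)
    (hs : ∀ t, ∃ α, lam ≤ α ∧ ∃ c, ∀ z : ℝ × ℝ, |z.2 - t| ≤ 1 / 4 →
      |w2 z - α * w11 z - c| ≤ g) (x s t : ℝ) (hs0 : s ∈ Set.Icc (0 : ℝ) 1) :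
    w (x + s, t) - w (x, t) ≤ g / lam := by
  set B := g / lam with hB
  have hB0 : 0 < B := by positivity
  set H : ℝ × ℝ × ℝ → ℝ := fun p => w (p.1 + p.2.1, p.2.2) - w (p.1, p.2.2) -
    B * (p.2.1 * (1 - p.2.1)) with hH
  have hw := h.cont
  have hHc : Continuous H := by rw [hH]; fun_prop
  have hK : IsCompact (Set.Icc (0 : ℝ) 1 ×ˢ (Set.Icc (0 : ℝ) 1 ×ˢ Set.Icc (0 : ℝ) 1)) :=
    isCompact_Icc.prod (isCompact_Icc.prod isCompact_Icc)
  obtain ⟨⟨x₀, s₀, t₀⟩, hp, hmax⟩ := hK.exists_isMaxOn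
    ⟨(0, 0, 0), by simp⟩ hHc.continuousOn
  have hmax' : ∀ x t, ∀ s ∈ Set.Icc (0 : ℝ) 1, H (x, s, t) ≤ H (x₀, s₀, t₀) := by
    intro x t s hs
    have e : H (x, s, t) = H (Int.fract x, s, Int.fract t) := by
      have e1 : w (Int.fract x + s, t) = w (x + s, t) := by
        rw [← PeriodicFn.add_fst h.per (Int.fract x + s) t ⌊x⌋,
          show Int.fract x + s + ⌊x⌋ = x + s by rw [add_right_comm, Int.fract_add_floor]]
      simp only [hH]
      rw [PeriodicFn.fract_snd h.per, PeriodicFn.fract_snd h.per, PeriodicFn.fract_fst h.per, e1]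
    rw [e]
    exact hmax ⟨fract_mem_Icc x, hs, fract_mem_Icc t⟩
  have hnonpos : H (x₀, s₀, t₀) ≤ 0 := by
    have hs₀ : s₀ ∈ Set.Icc (0 : ℝ) 1 := hp.2.1
    rcases hs₀.1.eq_or_lt with h0 | h0
    · simp [hH, ← h0]
    rcases hs₀.2.eq_or_lt with h1 | h1
    · have := PeriodicFn.add_fst h.per x₀ t₀ 1
      simp only [Int.cast_one] at this
      simp [hH, h1, this]
    exfalso
    have hnb : ∀ᶠ s in nhds s₀, s ∈ Set.Icc (0 : ℝ) 1 := Icc_mem_nhds h0 h1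
    have ht : w2 (x₀ + s₀, t₀) = w2 (x₀, t₀) := by
      have hm : IsLocalMax (fun t => H (x₀, s₀, t)) t₀ :=
        Filter.Eventually.of_forall fun t => hmax' x₀ t s₀ hs₀
      have := hm.hasDerivAt_eq_zero
        (((h.d2 (x₀ + s₀) t₀).sub (h.d2 x₀ t₀)).sub_const (B * (s₀ * (1 - s₀))))
      linarith
    have hq : ∀ s, HasDerivAt (fun s : ℝ => B * (s * (1 - s))) (B * (1 - 2 * s)) s := by
      intro s
      refine (((hasDerivAt_id s).mul ((hasDerivAt_id s).const_sub 1)).const_mul B).congr_deriv ?_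
      change B * (1 * (1 - s) + s * (-1)) = _
      ring
    have hql : ∀ s, HasDerivAt (fun s : ℝ => B * (1 - 2 * s)) (B * (-2)) s := by
      intro s
      simpa using (((hasDerivAt_id s).const_mul 2).const_sub 1).const_mul B
    have hsub : ∀ y : ℝ, HasDerivAt (fun y : ℝ => x₀ + y) 1 y := fun y =>
      (hasDerivAt_id y).const_add x₀
    have e1 : w11 (x₀ + s₀, t₀) - B * (-2) ≤ 0 := by
      have hm : IsLocalMax (fun s => w (x₀ + s, t₀) - B * (s * (1 - s))) s₀ := by
        filter_upwards [hnb] with s hs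
        have := hmax' x₀ t₀ s hs
        simp only [hH] at this
        linarith
      refine second_deriv_nonpos (f' := fun s => w1 (x₀ + s, t₀) - B * (1 - 2 * s)) hm
        (fun y => ?_) ?_
      · have := (HasDerivAt.comp (h₂ := fun s => w (s, t₀)) y (h.d1 (x₀ + y) t₀) (hsub y)).sub (hq y)
        rw [mul_one] at this
        exact this
      · have := (HasDerivAt.comp (h₂ := fun s => w1 (s, t₀)) s₀ (h.d11 (x₀ + s₀) t₀)
          (hsub s₀)).sub (hql s₀)
        rw [mul_one] at this
        exact this
    have e2 : -w11 (x₀, t₀) - B * (-2) ≤ 0 := by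
      have hm : IsLocalMax (fun x => -w (x, t₀) -
          B * ((x₀ + s₀ - x) * (1 - (x₀ + s₀ - x)))) x₀ := by
        have hc : Filter.Tendsto (fun x => x₀ + s₀ - x) (nhds x₀) (nhds s₀) := by
          have : Continuous fun x => x₀ + s₀ - x := by fun_prop
          simpa using this.tendsto x₀
        filter_upwards [hc.eventually hnb] with x hx
        have := hmax' x t₀ (x₀ + s₀ - x) hx
        simp only [hH, add_sub_cancel, add_sub_cancel_left] at this ⊢
        linarith
      have hsub' : ∀ y : ℝ, HasDerivAt (fun y : ℝ => x₀ + s₀ - y) (-1) y := fun y =>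
        (hasDerivAt_id y).const_sub (x₀ + s₀)
      refine second_deriv_nonpos (f' := fun x => -w1 (x, t₀) + B * (1 - 2 * (x₀ + s₀ - x))) hm
        (fun y => ?_) ?_
      · have := (h.d1 y t₀).neg.sub ((hq (x₀ + s₀ - y)).comp y (hsub' y))
        refine this.congr_deriv ?_
        ring
      · have := (h.d11 x₀ t₀).neg.add ((hql (x₀ + s₀ - x₀)).comp x₀ (hsub' x₀))
        refine this.congr_deriv ?_
        ring
    obtain ⟨α, hα, c, hc⟩ := hs t₀
    have b1 := abs_le.mp (hc (x₀ + s₀, t₀) (by simp))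
    have b2 := abs_le.mp (hc (x₀, t₀) (by simp))
    rw [ht] at b1
    have hα0 : 0 < α := hlam.trans_le hα
    have e3 : α * (w11 (x₀ + s₀, t₀)) ≤ α * (-(2 * B)) := by gcongr; linarith
    have e4 : α * (2 * B) ≤ α * w11 (x₀, t₀) := by gcongr; linarith
    have e5 : g ≤ α * B := by
      rw [hB, ← mul_div_assoc, le_div_iff₀ hlam]
      nlinarith
    nlinarith [b1.2, b2.1]
  have := (hmax' x t s hs0).trans hnonpos
  simp only [hH] at this
  have : B * (s * (1 - s)) ≤ B * 1 := by
    gcongr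
    nlinarith [hs0.1, hs0.2]
  linarith

lemma PeriodicC2.slice_osc (h : PeriodicC2 w w1 w11 w2) (hlam : 0 < lam) (hg : 0 < g)
    (hs : ∀ t, ∃ α, lam ≤ α ∧ ∃ c, ∀ z : ℝ × ℝ, |z.2 - t| ≤ 1 / 4 →
      |w2 z - α * w11 z - c| ≤ g) (x x' t : ℝ) : |w (x, t) - w (x', t)| ≤ g / lam := by
  have key : ∀ x x', w (x, t) - w (x', t) ≤ g / lam := by
    intro x x'
    have := h.slice_increment hlam hg hs x' (Int.fract (x - x')) t (fract_mem_Icc _)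
    rwa [← PeriodicFn.add_fst h.per _ t ⌊x - x'⌋,
      show x' + Int.fract (x - x') + ⌊x - x'⌋ = x by
        rw [add_assoc, Int.fract_add_floor]; ring] at this
  rw [abs_le]
  constructor <;> linarith [key x x', key x' x]

lemma PeriodicC2.mean_osc (h : PeriodicC2 w w1 w11 w2)
    (hs : ∀ t, ∃ α, lam ≤ α ∧ ∃ c, ∀ z : ℝ × ℝ, |z.2 - t| ≤ 1 / 4 →
      |w2 z - α * w11 z - c| ≤ g) (t t' : ℝ) (ht : t ∈ Set.Icc (0 : ℝ) 1)
    (ht' : t' ∈ Set.Icc (0 : ℝ) 1) :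
    |(∫ s in (0 : ℝ)..1, w (s, t)) - ∫ s in (0 : ℝ)..1, w (s, t')| ≤ 8 * g := by
  set W : ℝ → ℝ := fun t => ∫ s in (0 : ℝ)..1, w (s, t) with hW
  set W' : ℝ → ℝ := fun t => ∫ s in (0 : ℝ)..1, w2 (s, t) with hW'
  have c := h.cont
  have c2 := h.cont2
  have c11 := h.cont11
  have hper1 : ∀ t, w1 (1, t) = w1 (0, t) := by
    intro t
    have e : (fun s => w (s + 1, t)) = fun s => w (s, t) := by
      ext s; simpa using PeriodicFn.add_fst h.per s t 1
    have h1 := h.d1 0 t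
    rw [← e] at h1
    have h2 : HasDerivAt (fun s : ℝ => s + 1) 1 0 := (hasDerivAt_id 0).add_const 1
    have h3 := HasDerivAt.comp (h₂ := fun s => w (s, t)) (h := fun s : ℝ => s + 1) 0
      (h.d1 (0 + 1) t) h2
    rw [mul_one, zero_add] at h3
    exact h3.unique h1
  have hper2 : PeriodicFn w2 := by
    intro z k
    have e : (fun t => w (z.1 + k.1, t + k.2)) = fun t => w (z.1, t) := by
      ext t; exact h.per (z.1, t) k
    have h1 := h.d2 z.1 z.2
    rw [← e] at h1
    have h2 : HasDerivAt (fun s : ℝ => s + k.2) 1 z.2 := (hasDerivAt_id _).add_const _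
    have h3 := HasDerivAt.comp (h₂ := fun t => w (z.1 + k.1, t)) (h := fun s : ℝ => s + k.2) z.2
      (h.d2 (z.1 + k.1) (z.2 + k.2)) h2
    rw [mul_one] at h3
    exact h3.unique h1
  obtain ⟨N, hN⟩ := PeriodicFn.bounded hper2 c2
  have hderiv : ∀ t, HasDerivAt W (W' t) t := by
    intro t
    refine (intervalIntegral.hasDerivAt_integral_of_dominated_loc_of_deriv_le
      (F := fun t s => w (s, t)) (F' := fun t s => w2 (s, t)) (bound := fun _ => N)
      (s := Set.univ) Filter.univ_mem ?_ ?_ ?_ ?_ ?_ ?_).2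
    · exact Filter.Eventually.of_forall fun t =>
        (by fun_prop : Continuous fun s => w (s, t)).aestronglyMeasurable
    · exact (by fun_prop : Continuous fun s => w (s, t)).intervalIntegrable _ _
    · exact (by fun_prop : Continuous fun s => w2 (s, t)).aestronglyMeasurable
    · exact Filter.Eventually.of_forall fun s _ t _ => hN _
    · exact intervalIntegrable_const
    · exact Filter.Eventually.of_forall fun s _ t _ => h.d2 s t
  have h11 : ∀ t, ∫ s in (0 : ℝ)..1, w11 (s, t) = 0 := by
    intro t
    rw [intervalIntegral.integral_eq_sub_of_hasDerivAt (fun s _ => h.d11 s t)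
      ((by fun_prop : Continuous fun s => w11 (s, t)).intervalIntegrable _ _), hper1, sub_self]
  have hloc : ∀ t t', |t - t'| ≤ 1 / 4 → |W' t - W' t'| ≤ 2 * g := by
    intro t t' htt
    obtain ⟨α, -, c, hc⟩ := hs t
    have est : ∀ τ, |τ - t| ≤ 1 / 4 → |W' τ - c| ≤ g := by
      intro τ hτ
      have i1 : IntervalIntegrable (fun s => w2 (s, τ)) volume 0 1 :=
        (by fun_prop : Continuous fun s => w2 (s, τ)).intervalIntegrable _ _
      have i2 : IntervalIntegrable (fun s => α * w11 (s, τ)) volume 0 1 :=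
        (by fun_prop : Continuous fun s => α * w11 (s, τ)).intervalIntegrable _ _
      have e : W' τ - c = ∫ s in (0 : ℝ)..1, (w2 (s, τ) - α * w11 (s, τ) - c) := by
        rw [intervalIntegral.integral_sub (i1.sub i2) intervalIntegrable_const,
          intervalIntegral.integral_sub i1 i2, intervalIntegral.integral_const_mul, h11]
        simp [hW']
      rw [e]
      have := intervalIntegral.norm_integral_le_of_norm_le_const (a := (0 : ℝ)) (b := 1)
        (f := fun s => w2 (s, τ) - α * w11 (s, τ) - c) (C := g) (fun s _ => hc (s, τ) hτ)
      simpa using this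
    have b1 := abs_le.mp (est t (by simp))
    have b2 := abs_le.mp (est t' (by rwa [abs_sub_comm]))
    rw [abs_le]
    constructor <;> linarith [b1.1, b1.2, b2.1, b2.2]
  have hchain : ∀ t t', |t - t'| ≤ 1 → |W' t - W' t'| ≤ 8 * g := by
    intro t t' htt
    have step : ∀ k : ℝ, |W' (t + k * ((t' - t) / 4)) - W' (t + (k + 1) * ((t' - t) / 4))| ≤
        2 * g := by
      intro k
      apply hloc
      rw [show t + k * ((t' - t) / 4) - (t + (k + 1) * ((t' - t) / 4)) = (t - t') / 4 by ring,
        abs_div, abs_of_pos (by norm_num : (0 : ℝ) < 4)]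
      linarith
    have s0 := abs_le.mp (step 0)
    have s1 := abs_le.mp (step 1)
    have s2 := abs_le.mp (step 2)
    have s3 := abs_le.mp (step 3)
    norm_num at s0 s1 s2 s3
    rw [show t + 4 * ((t' - t) / 4) = t' by ring] at s3
    rw [abs_le]
    constructor <;> linarith [s0.1, s0.2, s1.1, s1.2, s2.1, s2.2, s3.1, s3.2]
  have hW01 : W 0 = W 1 := by
    simp only [hW]
    congr 1
    ext s
    simpa using (PeriodicFn.add_snd h.per s 0 1).symm
  obtain ⟨t₀, ht₀, hz⟩ := exists_hasDerivAt_eq_zero zero_lt_one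
    (fun t _ => (hderiv t).continuousAt.continuousWithinAt) hW01 (fun t _ => hderiv t)
  have hb : ∀ τ ∈ Set.Icc (0 : ℝ) 1, ‖W' τ‖ ≤ 8 * g := by
    intro τ hτ
    have := hchain τ t₀ (by rw [abs_le]; constructor <;> linarith [hτ.1, hτ.2, ht₀.1, ht₀.2])
    rwa [hz, sub_zero] at this
  have := (convex_Icc (0 : ℝ) 1).norm_image_sub_le_of_norm_hasDerivWithin_le
    (fun τ _ => (hderiv τ).hasDerivWithinAt) hb ht' ht
  refine this.trans ?_
  have hg : 0 ≤ 8 * g := (norm_nonneg _).trans (hb t ht)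
  have : ‖t - t'‖ ≤ 1 := by
    rw [Real.norm_eq_abs, abs_le]; constructor <;> linarith [ht.1, ht.2, ht'.1, ht'.2]
  nlinarith

lemma PeriodicC2.osc_le (h : PeriodicC2 w w1 w11 w2) (hlam : 0 < lam)
    (hs : ∀ t, ∃ α, lam ≤ α ∧ ∃ c, ∀ z : ℝ × ℝ, |z.2 - t| ≤ 1 / 4 →
      |w2 z - α * w11 z - c| ≤ g) (z z' : ℝ × ℝ) :
    |w z - w z'| ≤ (2 / lam + 8) * g := by
  have hg0 : 0 ≤ g := by
    obtain ⟨α, -, c, hc⟩ := hs 0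
    exact (abs_nonneg _).trans (hc (0, 0) (by simp))
  have key : ∀ δ > 0, |w z - w z'| ≤ 2 * ((g + δ) / lam) + 8 * g := by
    intro δ hδ
    have hs' : ∀ t, ∃ α, lam ≤ α ∧ ∃ c, ∀ z : ℝ × ℝ, |z.2 - t| ≤ 1 / 4 →
        |w2 z - α * w11 z - c| ≤ g + δ := by
      intro t
      obtain ⟨α, hα, c, hc⟩ := hs t
      exact ⟨α, hα, c, fun z hz => (hc z hz).trans (by linarith)⟩
    have c := h.cont
    have hsl : ∀ x t, |w (x, t) - ∫ s in (0 : ℝ)..1, w (s, t)| ≤ (g + δ) / lam := by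
      intro x t
      have e : w (x, t) - ∫ s in (0 : ℝ)..1, w (s, t) =
          ∫ s in (0 : ℝ)..1, (w (x, t) - w (s, t)) := by
        rw [intervalIntegral.integral_sub intervalIntegrable_const
          ((by fun_prop : Continuous fun s => w (s, t)).intervalIntegrable _ _)]
        simp
      rw [e]
      have := intervalIntegral.norm_integral_le_of_norm_le_const (a := (0 : ℝ)) (b := 1)
        (f := fun s => w (x, t) - w (s, t)) (C := (g + δ) / lam)
        (fun s _ => h.slice_osc hlam (by linarith) hs' x s t)
      simpa using this
    have e1 : w z = w (z.1, Int.fract z.2) := (PeriodicFn.fract_snd h.per _ _).symm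
    have e2 : w z' = w (z'.1, Int.fract z'.2) := (PeriodicFn.fract_snd h.per _ _).symm
    have b1 := abs_le.mp (hsl z.1 (Int.fract z.2))
    have b2 := abs_le.mp (hsl z'.1 (Int.fract z'.2))
    have b3 := abs_le.mp (h.mean_osc hs _ _ (fract_mem_Icc z.2) (fract_mem_Icc z'.2))
    rw [e1, e2, abs_le]
    constructor <;> linarith [b1.1, b1.2, b2.1, b2.2, b3.1, b3.2]
  refine le_of_forall_pos_le_add fun ε hε => ?_
  have := key (ε * lam / 2) (by positivity)
  refine this.trans (le_of_eq ?_)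
  field_simp
  ring

end

/-! ### The splitting and three-point conditions -/

/-- The exponents and the ellipticity constant in the integration theorem. -/
structure Params (lam κ : ℝ) (A : Finset ℝ) : Prop where
  lam_pos : 0 < lam
  lam_lt : lam < 1
  one_lt : 1 < κ
  lt_two : κ < 2
  exps : ∀ β ∈ A, 0 ≤ β ∧ β < κ

/-- The hypotheses of the integration theorem, with the mollification expressed by `Bop`. -/
structure Germ (lam κ : ℝ) (A : Finset ℝ) (U : ℝ × ℝ → ℝ × ℝ → ℝ) (a : ℝ × ℝ → ℝ)
    (γ : ℝ × ℝ → ℝ × ℝ → ℝ) (Mb Mbb : ℝ) : Prop where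
  bdd : ∀ x, BddCont (U x)
  per : ∀ x, PeriodicFn (U x)
  ellip : ∀ x, a x ∈ Set.Icc lam lam⁻¹
  nonneg : 0 ≤ Mb
  nonneg' : 0 ≤ Mbb
  split : ∀ x r L, 0 < r → r ≤ 1 → 0 < L → L ≤ 1 → ∃ c : ℝ, ∀ y, pdist y x ≤ L →
    |Bop 0 1 r (r ^ 2) (U x) y - a x * Bop 2 0 r (r ^ 2) (U x) y - c| ≤
      Mb * (r⁻¹) ^ 2 * ∑ β ∈ A, r ^ β * L ^ (κ - β)
  threePoint : ∀ x y z, |U x z - U x y - U y z + U y y - γ x y * (z.1 - y.1)| ≤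
    Mbb * ∑ β ∈ A, pdist y x ^ β * pdist z y ^ (κ - β)

section

variable {lam κ : ℝ} {A : Finset ℝ}

lemma Params.sum_le (P : Params lam κ A) {s t D : ℝ} (hs : 0 ≤ s) (ht : 0 ≤ t) (hD : 0 < D)
    (hsD : s ≤ D) (htD : t ≤ D) : ∑ β ∈ A, s ^ β * t ^ (κ - β) ≤ A.card * D ^ κ := by
  rw [← nsmul_eq_mul]
  refine Finset.sum_le_card_nsmul A _ _ fun β hβ => ?_
  obtain ⟨h0, h1⟩ := P.exps β hβ
  calc s ^ β * t ^ (κ - β) ≤ D ^ β * D ^ (κ - β) := by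
        gcongr
    _ = D ^ κ := by rw [← Real.rpow_add hD]; ring_nf

lemma Params.sum_le_growth (P : Params lam κ A) {r d : ℝ} (hr : 0 < r) (hd : 0 ≤ d) :
    ∑ β ∈ A, r ^ β * d ^ (κ - β) ≤ A.card * (r ^ κ * (1 + d / r) ^ 2) := by
  rw [← nsmul_eq_mul]
  refine Finset.sum_le_card_nsmul A _ _ fun β hβ => ?_
  obtain ⟨h0, h1⟩ := P.exps β hβ
  calc r ^ β * d ^ (κ - β) ≤ r ^ β * (r ^ (κ - β) * (1 + d / r) ^ 2) := by
        gcongr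
        exact rpow_le_growth hr hd (by linarith) (by linarith [P.lt_two])
    _ = r ^ κ * (1 + d / r) ^ 2 := by
        rw [← mul_assoc, ← Real.rpow_add hr]; ring_nf

lemma Params.two_rpow_le (P : Params lam κ A) : (2 : ℝ) ^ κ ≤ 4 := by
  calc (2 : ℝ) ^ κ ≤ 2 ^ (2 : ℝ) :=
        Real.rpow_le_rpow_of_exponent_le one_le_two P.lt_two.le
    _ = 4 := by norm_num

lemma Params.one_le_rpow_mul (P : Params lam κ A) {r : ℝ} (hr : 0 < r) (hr1 : r ≤ 1) :
    1 ≤ r ^ κ * (r⁻¹) ^ 2 := by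
  have h : r ^ (2 : ℝ) ≤ r ^ κ := Real.rpow_le_rpow_of_exponent_ge hr hr1 P.lt_two.le
  rw [Real.rpow_two] at h
  calc (1 : ℝ) = r ^ 2 * (r⁻¹) ^ 2 := by field_simp
    _ ≤ _ := by gcongr

lemma PeriodicFn.Bop {u : ℝ × ℝ → ℝ} (hu : PeriodicFn u) (i j : ℕ) (σ τ : ℝ) :
    PeriodicFn (Bop i j σ τ u) := by
  intro z k
  rw [Bop_eq, Bop_eq]
  congr 1
  ext w
  congr 1
  rw [← hu (z - w) k]
  congr 1
  ext <;> simp <;> ring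

lemma periodicC2_Bop {u : ℝ × ℝ → ℝ} (hu : BddCont u) (hp : PeriodicFn u) {σ τ : ℝ}
    (hσ : 0 < σ) (hτ : 0 < τ) :
    PeriodicC2 (Bop 0 0 σ τ u) (Bop 1 0 σ τ u) (Bop 2 0 σ τ u) (Bop 0 1 σ τ u) where
  per := PeriodicFn.Bop hp 0 0 σ τ
  cont := (bddCont_Bop 0 0 hσ hτ hu).1
  cont11 := (bddCont_Bop 2 0 hσ hτ hu).1
  cont2 := (bddCont_Bop 0 1 hσ hτ hu).1
  d1 := hasDerivAt_Bop_fst 0 0 hσ hτ hu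
  d11 := hasDerivAt_Bop_fst 1 0 hσ hτ hu
  d2 := hasDerivAt_Bop_snd 0 0 hσ hτ hu

variable {U : ℝ × ℝ → ℝ × ℝ → ℝ} {a : ℝ × ℝ → ℝ} {γ : ℝ × ℝ → ℝ × ℝ → ℝ} {Mb Mbb : ℝ}

lemma Germ.abs_gamma_le (P : Params lam κ A) (G : Germ lam κ A U a γ Mb Mbb) {x y : ℝ × ℝ}
    (hxy : pdist y x ≤ 1) : |γ x y| ≤ A.card * Mbb := by
  have h := G.threePoint x y (y.1 + 1, y.2)
  have e : ∀ v, U v (y.1 + 1, y.2) = U v y := fun v => by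
    simpa using PeriodicFn.add_fst (G.per v) y.1 y.2 1
  have hd : pdist (y.1 + 1, y.2) y = 1 := by simp [pdist]
  rw [e, e, hd] at h
  have h2 := P.sum_le (pdist_nonneg y x) zero_le_one one_pos hxy le_rfl
  rw [Real.one_rpow, mul_one] at h2
  simp only [add_sub_cancel_left, mul_one] at h
  calc |γ x y| = |U x y - U x y - U y y + U y y - γ x y| := by
        rw [← abs_neg]; congr 1; ring
    _ ≤ _ := h
    _ ≤ Mbb * A.card := mul_le_mul_of_nonneg_left h2 G.nonneg'
    _ = _ := mul_comm _ _

lemma Germ.sub_sub_le (P : Params lam κ A) (G : Germ lam κ A U a γ Mb Mbb) {x y : ℝ × ℝ}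
    (hxy : pdist y x ≤ 1) (z : ℝ × ℝ) :
    |U x z - U y z - (U x y - U y y)| ≤ 5 * A.card * Mbb := by
  set z' : ℝ × ℝ := (y.1 + Int.fract (z.1 - y.1), y.2 + Int.fract (z.2 - y.2)) with hz'
  have e : ∀ v, U v z = U v z' := fun v => by
    rw [← G.per v z' (⌊z.1 - y.1⌋, ⌊z.2 - y.2⌋)]
    congr 1
    ext
    · simp only [hz']; rw [add_assoc, Int.fract_add_floor]; ring
    · simp only [hz']; rw [add_assoc, Int.fract_add_floor]; ring
  have f1 := fract_mem_Icc (z.1 - y.1)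
  have f2 := fract_mem_Icc (z.2 - y.2)
  have hd : pdist z' y ≤ 2 := by
    simp only [pdist, hz', add_sub_cancel_left]
    rw [abs_of_nonneg f1.1, abs_of_nonneg f2.1]
    have : √(Int.fract (z.2 - y.2)) ≤ 1 := Real.sqrt_le_one.mpr f2.2
    linarith [f1.2]
  have h := G.threePoint x y z'
  have h2 := P.sum_le (pdist_nonneg y x) (pdist_nonneg z' y) two_pos (by linarith) hd
  have h3 : Mbb * ∑ β ∈ A, pdist y x ^ β * pdist z' y ^ (κ - β) ≤ Mbb * (A.card * 4) := by
    refine mul_le_mul_of_nonneg_left (h2.trans ?_) G.nonneg'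
    have := P.two_rpow_le
    gcongr
  have h4 : |γ x y * (z'.1 - y.1)| ≤ A.card * Mbb := by
    rw [abs_mul]
    have : |z'.1 - y.1| ≤ 1 := by
      simp only [hz', add_sub_cancel_left]
      rw [abs_of_nonneg f1.1]
      exact f1.2
    calc _ ≤ A.card * Mbb * 1 := by
          gcongr
          · exact mul_nonneg (by positivity) G.nonneg'
          · exact G.abs_gamma_le P hxy
      _ = _ := mul_one _
  rw [e, e]
  have b1 := abs_le.mp (h.trans h3)
  have b2 := abs_le.mp h4
  rw [abs_le]
  constructor <;> linarith [b1.1, b1.2, b2.1, b2.2]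

lemma Germ.Bop_sub_le (P : Params lam κ A) (i j : ℕ) (hij : 1 ≤ i + j) : ∃ C : ℝ, 0 < C ∧
    ∀ {U a γ Mb Mbb}, Germ lam κ A U a γ Mb Mbb → ∀ {x y : ℝ × ℝ}, pdist y x ≤ 1 →
      ∀ r, 0 < r → ∀ z, |Bop i j r (r ^ 2) (U x) z - Bop i j r (r ^ 2) (U y) z| ≤
        C * Mbb * (r⁻¹) ^ (i + 2 * j) := by
  obtain ⟨C, hC0, hC⟩ := Bop_growth i j 0 1 1 one_pos
  refine ⟨C * (5 * A.card + 1), by positivity, fun {U a γ Mb Mbb} G x y hxy r hr z => ?_⟩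
  have hr2 : 0 < r ^ 2 := by positivity
  have hb := (G.bdd x).sub (G.bdd y)
  have hc := hb.sub (bddCont_const (U x y - U y y))
  have h := (hC 1 (by simp) 1 (by simp) r hr (fun y' => U x y' - U y y' - (U x y - U y y)) z z
    (5 * A.card * Mbb) hc.1 fun y' => by simpa using G.sub_sub_le P hxy y').2
  rw [one_mul, one_mul, Bop_sub_const i j hij hr hr2 hb,
    Bop_sub i j hr hr2 (G.bdd x) (G.bdd y), pow_zero, mul_one] at h
  refine h.trans ?_
  have := G.nonneg'
  have : 0 ≤ C * Mbb * (r⁻¹) ^ (i + 2 * j) := by positivity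
  linarith

lemma Germ.osc_le (P : Params lam κ A) : ∃ C : ℝ, 0 < C ∧
    ∀ {U a γ Mb Mbb}, Germ lam κ A U a γ Mb Mbb → ∀ x r, 0 < r → r ≤ 1 → ∀ z z',
      |Bop 0 0 r (r ^ 2) (U x) z - Bop 0 0 r (r ^ 2) (U x) z'| ≤
        C * (Mb + Mbb) * (r⁻¹) ^ 2 := by
  obtain ⟨C1, hC10, hC1⟩ := Germ.Bop_sub_le P 0 1 (by norm_num)
  obtain ⟨C2, hC20, hC2⟩ := Germ.Bop_sub_le P 2 0 (by norm_num)
  have hlam := P.lam_pos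
  refine ⟨(2 / lam + 8) * (A.card + C1 + lam⁻¹ * C2), by positivity,
    fun {U a γ Mb Mbb} G x r hr hr1 z z' => ?_⟩
  have hr2 : 0 < r ^ 2 := by positivity
  have hMb := G.nonneg
  have hMbb := G.nonneg'
  have key := (periodicC2_Bop (G.bdd x) (G.per x) hr hr2).osc_le hlam
    (g := (A.card + C1 + lam⁻¹ * C2) * (Mb + Mbb) * (r⁻¹) ^ 2) (fun t => ?_) z z'
  · refine key.trans (le_of_eq ?_); ring
  set k : ℤ := round (t - x.2) with hk
  set y : ℝ × ℝ := (x.1, t - k) with hy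
  have hyx : pdist y x ≤ 1 := by
    have := abs_sub_round (t - x.2)
    simp only [pdist, hy, sub_self, abs_zero, zero_add]
    refine Real.sqrt_le_one.mpr ?_
    rw [sub_right_comm]
    linarith
  obtain ⟨c, hc⟩ := G.split y r 1 hr hr1 one_pos le_rfl
  obtain ⟨ha1, ha2⟩ := G.ellip y
  refine ⟨a y, ha1, c, fun z hz => ?_⟩
  set z' : ℝ × ℝ := (z.1 + ((-round (z.1 - x.1) : ℤ) : ℝ), z.2 + ((-k : ℤ) : ℝ)) with hz'
  have hd : pdist z' y ≤ 1 := by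
    have h1 := abs_sub_round (z.1 - x.1)
    have h2 : √|z.2 - t| ≤ 1 / 2 := by
      rw [Real.sqrt_le_left (by norm_num)]
      linarith
    simp only [pdist, hz', hy]
    push_cast
    rw [show z.1 + -(round (z.1 - x.1) : ℝ) - x.1 = z.1 - x.1 - round (z.1 - x.1) by ring,
      show z.2 + -(k : ℝ) - (t - k) = z.2 - t by ring]
    linarith
  have h := hc z' hd
  have hper : ∀ i j, Bop i j r (r ^ 2) (U y) z' = Bop i j r (r ^ 2) (U y) z := fun i j =>
    PeriodicFn.Bop (G.per y) i j r (r ^ 2) z (-round (z.1 - x.1), -k)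
  rw [hper, hper] at h
  have hS := P.sum_le hr.le zero_le_one one_pos hr1 le_rfl
  rw [Real.one_rpow, mul_one] at hS
  have h' := h.trans (mul_le_mul_of_nonneg_left hS (by positivity))
  have e1 := abs_le.mp (hC1 G hyx r hr z)
  have e2 := hC2 G hyx r hr z
  have e3 : |a y * (Bop 2 0 r (r ^ 2) (U x) z - Bop 2 0 r (r ^ 2) (U y) z)| ≤
      lam⁻¹ * (C2 * Mbb * r⁻¹ ^ (2 + 2 * 0)) := by
    rw [abs_mul, abs_of_pos (hlam.trans_le ha1)]
    gcongr
  have e3 := abs_le.mp e3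
  have e4 := abs_le.mp h'
  norm_num only at e1 e3
  have p1 : 0 ≤ Mb * (r⁻¹) ^ 2 := by positivity
  have p2 : 0 ≤ Mbb * (r⁻¹) ^ 2 * A.card := by positivity
  have p3 : 0 ≤ C1 * (Mb * (r⁻¹) ^ 2) := by positivity
  have p4 : 0 ≤ lam⁻¹ * C2 * (Mb * (r⁻¹) ^ 2) := by positivity
  rw [abs_le]
  constructor <;> nlinarith [e1.1, e1.2, e3.1, e3.2, e4.1, e4.2]

lemma Germ.abs_Bop_le (P : Params lam κ A) (i j : ℕ) (hij : 1 ≤ i + j) : ∃ C : ℝ, 0 < C ∧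
    ∀ {U a γ Mb Mbb}, Germ lam κ A U a γ Mb Mbb → ∀ x r, 0 < r → r ≤ 1 → ∀ z,
      |Bop i j r (r ^ 2) (U x) z| ≤ C * (Mb + Mbb) * (r⁻¹) ^ (i + 2 * j + 2) := by
  obtain ⟨C1, hC10, hC1⟩ := Bop_growth i j 0 1 1 one_pos
  obtain ⟨C2, hC20, hC2⟩ := Germ.osc_le P
  set q : ℝ := √√(1 / 2) with hq
  have hq0 : 0 < q := by positivity
  have hq4 : q ^ 4 = 1 / 2 := by
    rw [show q ^ 4 = (q ^ 2) ^ 2 by ring, hq, Real.sq_sqrt (by positivity),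
      Real.sq_sqrt (by positivity)]
  have hq1 : q ≤ 1 := by
    rw [hq]
    exact Real.sqrt_le_one.mpr (Real.sqrt_le_one.mpr (by norm_num))
  refine ⟨C1 * C2 * (q⁻¹) ^ (i + 2 * j + 2), by positivity, fun {U a γ Mb Mbb} G x r hr hr1 z => ?_⟩
  have hr2 : 0 < r ^ 2 := by positivity
  have hs : 0 < q * r := by positivity
  have hs2 : 0 < (q * r) ^ 2 := by positivity
  have hs1 : q * r ≤ 1 := by nlinarith
  set w := Bop 0 0 (q * r) ((q * r) ^ 2) (U x) with hw
  have hwb : BddCont w := bddCont_Bop 0 0 hs hs2 (G.bdd x)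
  have e : Bop i j r (r ^ 2) (U x) z = Bop i j (q * r) ((q * r) ^ 2) (fun y => w y - w z) z := by
    rw [Bop_sub_const i j hij hs hs2 hwb, hw, Bop_Bop i j 0 0 hs hs2 hs hs2 hr hr2 _ _ (G.bdd x),
      add_zero, add_zero]
    · rw [mul_pow, hq4]; ring
    · rw [show ((q * r) ^ 2) ^ 2 = q ^ 4 * r ^ 4 by ring, hq4]; ring
  have h := (hC1 1 (by simp) 1 (by simp) (q * r) hs (fun y => w y - w z) z z
    (C2 * (Mb + Mbb) * ((q * r)⁻¹) ^ 2) (hwb.sub (bddCont_const _)).1 fun y => by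
      simpa using hC2 G x (q * r) hs hs1 y z).2
  rw [one_mul, one_mul, ← e, pow_zero, mul_one] at h
  refine h.trans (le_of_eq ?_)
  rw [mul_inv, pow_add (q⁻¹), pow_add (r⁻¹), mul_pow, mul_pow]
  ring

lemma Germ.defect_le (P : Params lam κ A) : ∃ C : ℝ, 0 < C ∧
    ∀ {U a γ Mb Mbb}, Germ lam κ A U a γ Mb Mbb → ∀ x r, 0 < r → r ≤ 1 → ∀ z,
      |(Bop 0 1 r (r ^ 2) (U x) z - a x * Bop 2 0 r (r ^ 2) (U x) z) -
        (Bop 0 1 r (r ^ 2) (U x) x - a x * Bop 2 0 r (r ^ 2) (U x) x)| ≤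
        C * (Mb + Mbb) * (r ^ κ * (r⁻¹) ^ 2) * (1 + pdist z x / r) ^ 4 := by
  obtain ⟨C1, hC10, hC1⟩ := Germ.abs_Bop_le P 0 1 (by norm_num)
  obtain ⟨C2, hC20, hC2⟩ := Germ.abs_Bop_le P 2 0 (by norm_num)
  have hlam := P.lam_pos
  refine ⟨2 * (A.card + C1 + lam⁻¹ * C2), by positivity, fun {U a γ Mb Mbb} G x r hr hr1 z => ?_⟩
  have hMb := G.nonneg
  have hMbb := G.nonneg'
  obtain ⟨ha1, ha2⟩ := G.ellip x
  have hd0 := pdist_nonneg z x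
  set d := pdist z x with hd
  have hrk : 0 < r ^ κ := Real.rpow_pos_of_pos hr κ
  have hdr : 0 ≤ d / r := by positivity
  rcases eq_or_ne z x with rfl | hzx
  · rw [sub_self, abs_zero]; positivity
  rcases le_or_gt d 1 with h1 | h1
  · obtain ⟨c, hc⟩ := G.split x r d hr hr1 (pdist_pos hzx) h1
    have b1 := hc z le_rfl
    have b2 := hc x (by rw [pdist_self]; exact hd0)
    have hS : Mb * (r⁻¹) ^ 2 * ∑ β ∈ A, r ^ β * d ^ (κ - β) ≤
        (A.card + C1 + lam⁻¹ * C2) * (Mb + Mbb) * (r ^ κ * (r⁻¹) ^ 2) * (1 + d / r) ^ 4 := by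
      calc _ ≤ Mb * (r⁻¹) ^ 2 * (A.card * (r ^ κ * (1 + d / r) ^ 2)) := by
            gcongr
            exact P.sum_le_growth hr hd0
        _ = A.card * Mb * (r ^ κ * (r⁻¹) ^ 2) * (1 + d / r) ^ 2 := by ring
        _ ≤ _ := by
            gcongr
            · linarith [show 0 ≤ C1 + lam⁻¹ * C2 by positivity]
            · linarith
            · linarith
            · norm_num
    have b1 := abs_le.mp (b1.trans hS)
    have b2 := abs_le.mp (b2.trans hS)
    rw [abs_le]
    constructor <;> linarith [b1.1, b1.2, b2.1, b2.2]
  · have hbd : ∀ z, |Bop 0 1 r (r ^ 2) (U x) z - a x * Bop 2 0 r (r ^ 2) (U x) z| ≤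
        (A.card + C1 + lam⁻¹ * C2) * (Mb + Mbb) * (r ^ κ * (r⁻¹) ^ 2) * (1 + d / r) ^ 4 := by
      intro z
      have b1 := hC1 G x r hr hr1 z
      have b2 := hC2 G x r hr hr1 z
      calc _ ≤ |Bop 0 1 r (r ^ 2) (U x) z| + |a x * Bop 2 0 r (r ^ 2) (U x) z| := abs_sub _ _
        _ ≤ C1 * (Mb + Mbb) * (r⁻¹) ^ 4 + lam⁻¹ * (C2 * (Mb + Mbb) * (r⁻¹) ^ 4) := by
            rw [abs_mul, abs_of_pos (hlam.trans_le ha1)]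
            gcongr
        _ = (C1 + lam⁻¹ * C2) * (Mb + Mbb) * 1 * (r⁻¹) ^ 4 := by ring
        _ ≤ _ := by
            gcongr
            · linarith [show (0 : ℝ) ≤ A.card by positivity]
            · exact P.one_le_rpow_mul hr hr1
            · rw [inv_eq_one_div]
              have : 1 / r ≤ d / r := by gcongr
              linarith
    have b1 := abs_le.mp (hbd z)
    have b2 := abs_le.mp (hbd x)
    rw [abs_le]
    constructor <;> linarith [b1.1, b1.2, b2.1, b2.2]

end

/-! ### Calculus lemmas -/

lemma abs_sub_le_sub_of_hasDerivAt {F F' g g' : ℝ → ℝ} {s t : ℝ} (hst : s ≤ t)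
    (hF : ∀ r ∈ Set.Icc s t, HasDerivAt F (F' r) r) (hg : ∀ r ∈ Set.Icc s t, HasDerivAt g (g' r) r)
    (hb : ∀ r ∈ Set.Icc s t, |F' r| ≤ g' r) : |F t - F s| ≤ g t - g s := by
  have key : ∀ G G' : ℝ → ℝ, (∀ r ∈ Set.Icc s t, HasDerivAt G (G' r) r) →
      (∀ r ∈ Set.Icc s t, G' r ≤ g' r) → G t - G s ≤ g t - g s := by
    intro G G' hG hb
    have hm : MonotoneOn (fun r => g r - G r) (Set.Icc s t) := by
      refine monotoneOn_of_hasDerivWithinAt_nonneg (convex_Icc s t)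
        (fun r hr => ((hg r hr).sub (hG r hr)).continuousAt.continuousWithinAt)
        (fun r hr => ((hg r (interior_subset hr)).sub
          (hG r (interior_subset hr))).hasDerivWithinAt)
        (fun r hr => by linarith [hb r (interior_subset hr)])
    have := hm (Set.left_mem_Icc.mpr hst) (Set.right_mem_Icc.mpr hst) hst
    simp only at this
    linarith
  have h1 := key F F' hF fun r hr => (abs_le.mp (hb r hr)).2
  have h2 := key (-F) (fun r => -F' r) (fun r hr => (hF r hr).neg)
    fun r hr => by linarith [(abs_le.mp (hb r hr)).1]
  simp only [Pi.neg_apply] at h2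
  rw [abs_le]
  constructor <;> linarith

lemma abs_sub_le_of_rpow_deriv {F F' : ℝ → ℝ} {K p : ℝ} (hK : 0 ≤ K) (hp : 0 < p)
    (hF : ∀ r, 0 < r → r ≤ 1 → HasDerivAt F (F' r) r)
    (hb : ∀ r, 0 < r → r ≤ 1 → |F' r| ≤ K * r ^ (p - 1)) {s t : ℝ} (hs : 0 < s) (hst : s ≤ t)
    (ht : t ≤ 1) : |F t - F s| ≤ K / p * t ^ p := by
  have h := abs_sub_le_sub_of_hasDerivAt (F := F) (F' := F') (g := fun r => K / p * r ^ p)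
    (g' := fun r => K * r ^ (p - 1)) hst
    (fun r hr => hF r (hs.trans_le hr.1) (hr.2.trans ht))
    (fun r hr => by
      refine ((Real.hasDerivAt_rpow_const (p := p)
        (Or.inl (hs.trans_le hr.1).ne')).const_mul (K / p)).congr_deriv ?_
      field_simp)
    (fun r hr => hb r (hs.trans_le hr.1) (hr.2.trans ht))
  have : 0 ≤ K / p * s ^ p := by positivity
  linarith

lemma abs_le_of_rpow_deriv {F F' : ℝ → ℝ} {K p s : ℝ} (hK : 0 ≤ K) (hp : p < 0) (hs : 0 < s)
    (hs1 : s ≤ 1) (hF : ∀ r, s ≤ r → r ≤ 1 → HasDerivAt F (F' r) r)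
    (hb : ∀ r, s ≤ r → r ≤ 1 → |F' r| ≤ K * r ^ (p - 1)) :
    |F s| ≤ |F 1| + K / (-p) * s ^ p := by
  have h := abs_sub_le_sub_of_hasDerivAt (F := F) (F' := F') (g := fun r => K / p * r ^ p)
    (g' := fun r => K * r ^ (p - 1)) hs1 (fun r hr => hF r hr.1 hr.2)
    (fun r hr => by
      refine ((Real.hasDerivAt_rpow_const (p := p)
        (Or.inl (hs.trans_le hr.1).ne')).const_mul (K / p)).congr_deriv ?_
      field_simp [hp.ne])
    (fun r hr => hb r hr.1 hr.2)
  have h1 : K / p ≤ 0 := div_nonpos_of_nonneg_of_nonpos hK hp.le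
  have h2 := abs_sub_abs_le_abs_sub (F s) (F 1)
  rw [abs_sub_comm] at h2
  rw [div_neg]
  simp only [Real.one_rpow, mul_one] at h
  linarith

lemma exists_limit_of_abs_sub_le {F g : ℝ → ℝ}
    (h : ∀ s t, 0 < s → s ≤ t → t ≤ 1 → |F t - F s| ≤ g t) :
    ∃ l, ∀ t, 0 < t → t ≤ 1 → |F t - l| ≤ g t := by
  set S := (fun t => F t - g t) '' Set.Ioc (0 : ℝ) 1 with hS
  have hg : ∀ t, 0 < t → t ≤ 1 → 0 ≤ g t := fun t h0 h1 =>
    (abs_nonneg _).trans (h t t h0 le_rfl h1)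
  have hub : ∀ t, 0 < t → t ≤ 1 → ∀ b ∈ S, b ≤ F t + g t := by
    rintro t ht ht1 _ ⟨s, ⟨hs, hs1⟩, rfl⟩
    have := hg s hs hs1
    have := hg t ht ht1
    rcases le_total s t with hst | hst
    · linarith [(abs_le.mp (h s t hs hst ht1)).1]
    · linarith [(abs_le.mp (h t s ht hst hs1)).2]
  have hne : S.Nonempty := ⟨_, 1, by simp, rfl⟩
  refine ⟨sSup S, fun t ht ht1 => ?_⟩
  have h1 : F t - g t ≤ sSup S :=
    le_csSup ⟨_, fun b hb => hub 1 one_pos le_rfl b hb⟩ ⟨t, ⟨ht, ht1⟩, rfl⟩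
  have h2 : sSup S ≤ F t + g t := csSup_le hne (hub t ht ht1)
  rw [abs_le]
  constructor <;> linarith

/-! ### The scales adapted to the frozen coefficient -/

/-- The fourth root. -/
def root4 (X : ℝ) : ℝ := √√X

lemma root4_pow {X : ℝ} (hX : 0 ≤ X) : root4 X ^ 4 = X := by
  rw [root4, show ∀ q : ℝ, q ^ 4 = (q ^ 2) ^ 2 by intro q; ring, Real.sq_sqrt (by positivity),
    Real.sq_sqrt hX]

lemma root4_mem {m M X : ℝ} (hM : 0 ≤ M) (h1 : m ^ 4 ≤ X) (h2 : X ≤ M ^ 4) :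
    root4 X ∈ Set.Icc m M := by
  have e := root4_pow (le_trans (by positivity) h1)
  have h0 : 0 ≤ root4 X := Real.sqrt_nonneg _
  constructor
  · by_contra! hlt
    have := pow_lt_pow_left₀ hlt h0 (by norm_num : 4 ≠ 0)
    linarith
  · by_contra! hlt
    have := pow_lt_pow_left₀ hlt hM (by norm_num : 4 ≠ 0)
    linarith

/-- The spatial scale for which the frozen operator `∂₂ - a ∂₁²` factors the scale derivative. -/
def spScale (a : ℝ) : ℝ := root4 (4 * Real.pi ^ 2 * a ^ 2)

section

variable {lam κ : ℝ} {A : Finset ℝ}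

lemma spScale_pow (a : ℝ) : spScale a ^ 4 = 4 * Real.pi ^ 2 * a ^ 2 := root4_pow (by positivity)

lemma Params.three_div (P : Params lam κ A) {a : ℝ} (ha : a ∈ Set.Icc lam lam⁻¹) :
    4 * Real.pi ^ 2 * a ^ 2 ≤ (3 / lam) ^ 4 := by
  have h0 := P.lam_pos
  have h1 : 1 ≤ lam⁻¹ := (one_le_inv₀ h0).mpr P.lam_lt.le
  have h2 : Real.pi ^ 2 ≤ 10 := by nlinarith [Real.pi_lt_d2, Real.pi_pos]
  have h3 : a ^ 2 ≤ lam⁻¹ ^ 2 := by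
    exact pow_le_pow_left₀ (h0.le.trans ha.1) ha.2 2
  have h4 : lam⁻¹ ^ 2 ≤ lam⁻¹ ^ 4 := pow_le_pow_right₀ h1 (by norm_num)
  calc 4 * Real.pi ^ 2 * a ^ 2 ≤ 4 * 10 * lam⁻¹ ^ 4 := by
        gcongr
        exact h3.trans h4
    _ ≤ 81 * lam⁻¹ ^ 4 := by gcongr; norm_num
    _ = _ := by rw [div_eq_mul_inv]; ring

lemma Params.scale_lower (P : Params lam κ A) {a : ℝ} (ha : a ∈ Set.Icc lam lam⁻¹) :
    (lam / 2) ^ 4 ≤ 4 * Real.pi ^ 2 * a ^ 2 / 2 := by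
  have h0 := P.lam_pos
  have h2 : 9 ≤ Real.pi ^ 2 := by nlinarith [Real.pi_gt_three]
  have h3 : lam ^ 2 ≤ a ^ 2 := by have := ha.1; gcongr
  have h4 : lam ^ 4 ≤ lam ^ 2 := pow_le_pow_of_le_one h0.le P.lam_lt.le (by norm_num)
  have h5 : 9 * a ^ 2 ≤ Real.pi ^ 2 * a ^ 2 := by gcongr
  rw [div_pow]
  nlinarith [sq_nonneg a]

lemma Params.spScale_mem (P : Params lam κ A) {a : ℝ} (ha : a ∈ Set.Icc lam lam⁻¹) :
    spScale a ∈ Set.Icc (lam / 2) (3 / lam) := by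
  have h0 := P.lam_pos
  refine root4_mem (by positivity) ?_ (P.three_div ha)
  have := P.scale_lower ha
  have : 0 ≤ 4 * Real.pi ^ 2 * a ^ 2 := by positivity
  linarith

lemma Params.root4_sub_mem (P : Params lam κ A) {a X : ℝ} (ha : a ∈ Set.Icc lam lam⁻¹)
    (hX0 : 0 ≤ X) (hX : X ≤ 4 * Real.pi ^ 2 * a ^ 2 / 2) :
    root4 (4 * Real.pi ^ 2 * a ^ 2 - X) ∈ Set.Icc (lam / 2) (3 / lam) ∧
      spScale a ^ 4 = root4 (4 * Real.pi ^ 2 * a ^ 2 - X) ^ 4 + X := by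
  have h0 := P.lam_pos
  have h1 := P.scale_lower ha
  have h2 := P.three_div ha
  constructor
  · exact root4_mem (by positivity) (by linarith) (by linarith)
  · rw [root4_pow, spScale_pow]
    · ring
    · have : 0 ≤ 4 * Real.pi ^ 2 * a ^ 2 := by positivity
      linarith

lemma Params.timeScale_mem (P : Params lam κ A) :
    √(1 - (lam / 2) ^ 4) ∈ Set.Icc (lam / 2) (3 / lam) ∧
      √(1 - (lam / 2) ^ 4) ^ 2 = 1 - (lam / 2) ^ 4 := by
  have h0 := P.lam_pos
  have h1 := P.lam_lt
  have h4 : (lam / 2) ^ 2 ≤ 1 / 4 := by nlinarith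
  have h5 : (lam / 2) ^ 4 ≤ 1 / 16 := by
    rw [show (lam / 2) ^ 4 = ((lam / 2) ^ 2) ^ 2 by ring]
    nlinarith [sq_nonneg (lam / 2)]
  refine ⟨⟨Real.le_sqrt_of_sq_le (by linarith), ?_⟩, Real.sq_sqrt (by linarith)⟩
  have h6 : (1 : ℝ) ≤ 3 / lam := by rw [le_div_iff₀ h0]; linarith
  refine le_trans (Real.sqrt_le_one.mpr ?_) h6
  have : 0 ≤ (lam / 2) ^ 4 := by positivity
  linarith

lemma Params.one_mem (P : Params lam κ A) : (1 : ℝ) ∈ Set.Icc (lam / 2) (3 / lam) := by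
  have h0 := P.lam_pos
  have h1 := P.lam_lt
  exact ⟨by linarith, by rw [le_div_iff₀ h0]; linarith⟩

lemma Params.half_pos (P : Params lam κ A) : 0 < lam / 2 := _root_.half_pos P.lam_pos

/-- Factorisation of the adapted convolution through the reference mollification. -/
lemma Params.exists_factor (P : Params lam κ A) {a : ℝ} (ha : a ∈ Set.Icc lam lam⁻¹) :
    ∃ A' ∈ Set.Icc (lam / 2) (3 / lam), ∃ B' ∈ Set.Icc (lam / 2) (3 / lam),
      ∀ (i j i' j' : ℕ) (r : ℝ), 0 < r → ∀ u, BddCont u → ∀ z,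
        Bop i j (A' * r) (B' * r ^ 2) (Bop i' j' (lam / 2 * r) ((lam / 2 * r) ^ 2) u) z =
          Bop (i + i') (j + j') (spScale a * r) (1 * r ^ 2) u z := by
  have h0 := P.half_pos
  have h1 := P.scale_lower ha
  obtain ⟨hA, hA4⟩ := P.root4_sub_mem ha (X := (lam / 2) ^ 4) (by positivity) h1
  obtain ⟨hB, hB2⟩ := P.timeScale_mem
  refine ⟨_, hA, _, hB, fun i j i' j' r hr u hu z => ?_⟩
  have hA0 := h0.trans_le hA.1
  have hB0 := h0.trans_le hB.1
  have hs0 := h0.trans_le (P.spScale_mem ha).1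
  refine Bop_Bop i j i' j' (by positivity) (by positivity) (by positivity) (by positivity)
    (by positivity) (by positivity) ?_ ?_ hu z
  · rw [mul_pow, hA4]; ring
  · rw [mul_pow (√(1 - (lam / 2) ^ 4)), hB2]; ring

end

/-! ### Convergence of the adapted convolution -/

section

variable {lam κ : ℝ} {A : Finset ℝ}

lemma hasDerivAt_adapted (i j : ℕ) {a : ℝ} (ha : 0 < spScale a) {u : ℝ × ℝ → ℝ} (hu : BddCont u)
    (z : ℝ × ℝ) {r : ℝ} (hr : 0 < r) :
    HasDerivAt (fun r => Bop i j (spScale a * r) (1 * r ^ 2) u z)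
      (r ^ 3 / Real.pi ^ 2 * (Bop i (j + 2) (spScale a * r) (1 * r ^ 2) u z -
        a ^ 2 * Bop (i + 4) j (spScale a * r) (1 * r ^ 2) u z)) r := by
  refine (hasDerivAt_Bop_scale i j ha one_pos hu z hr).congr_deriv ?_
  have hpi := Real.pi_ne_zero
  rw [spScale_pow, odeConst, odeConst]
  field_simp
  push_cast
  ring

lemma one_add_div_mul_le {e r d : ℝ} (he : 0 < e) (he1 : e ≤ 1) (hr : 0 < r) :
    1 + d / (e * r) ≤ e⁻¹ * (1 + d / r) := by
  have h1 : 1 ≤ e⁻¹ := (one_le_inv₀ he).mpr he1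
  have h2 : d / (e * r) = e⁻¹ * (d / r) := by field_simp
  rw [h2, mul_add]
  linarith

lemma Germ.adapted_deriv_le (P : Params lam κ A) (i j : ℕ) : ∃ C : ℝ, 0 < C ∧
    ∀ {U a γ Mb Mbb}, Germ lam κ A U a γ Mb Mbb → ∀ x r, 0 < r → r ≤ 1 → ∀ z,
      |r ^ 3 / Real.pi ^ 2 * (Bop i (j + 2) (spScale (a x) * r) (1 * r ^ 2) (U x) z -
        a x ^ 2 * Bop (i + 4) j (spScale (a x) * r) (1 * r ^ 2) (U x) z)| ≤
        C * (Mb + Mbb) * (r ^ κ * (r⁻¹) ^ (i + 2 * j + 1)) * (1 + pdist z x / r) ^ 4 := by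
  have h0 := P.half_pos
  obtain ⟨C0, hC00, hC0⟩ := Germ.defect_le P
  obtain ⟨C1, hC10, hC1⟩ := Bop_growth i (j + 1) 4 (lam / 2) (3 / lam) h0
  obtain ⟨C2, hC20, hC2⟩ := Bop_growth (i + 2) j 4 (lam / 2) (3 / lam) h0
  set e := lam / 2 with he
  have he1 : e ≤ 1 := P.one_mem.1
  have hlam := P.lam_pos
  refine ⟨(C1 + lam⁻¹ * C2) * (C0 * (e⁻¹) ^ 6), by positivity,
    fun {U a γ Mb Mbb} G x r hr hr1 z => ?_⟩
  have hMb := G.nonneg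
  have hMbb := G.nonneg'
  obtain ⟨A', hA', B', hB', hf⟩ := P.exists_factor (G.ellip x)
  have ha0 : 0 < a x := hlam.trans_le (G.ellip x).1
  have her : 0 < e * r := by positivity
  have her2 : 0 < (e * r) ^ 2 := by positivity
  have her1 : e * r ≤ 1 := by nlinarith
  set s := spScale (a x) with hs
  have hA0 : 0 < A' * r := mul_pos (h0.trans_le hA'.1) hr
  have hB0 : 0 < B' * r ^ 2 := mul_pos (h0.trans_le hB'.1) (by positivity)
  set b1 := Bop 0 1 (e * r) ((e * r) ^ 2) (U x) with hb1
  set b2 := Bop 2 0 (e * r) ((e * r) ^ 2) (U x) with hb2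
  have c1 : BddCont b1 := bddCont_Bop 0 1 her her2 (G.bdd x)
  have c2 : BddCont b2 := bddCont_Bop 2 0 her her2 (G.bdd x)
  set f := fun y => b1 y - a x * b2 y with hfdef
  have cf : BddCont f := c1.sub (c2.const_mul (a x))
  have hop : ∀ i j, 1 ≤ i + j → Bop i j (A' * r) (B' * r ^ 2) (fun y => f y - f x) z =
      Bop i (j + 1) (s * r) (1 * r ^ 2) (U x) z -
        a x * Bop (i + 2) j (s * r) (1 * r ^ 2) (U x) z := by
    intro i j hij
    rw [Bop_sub_const i j hij hA0 hB0 cf, hfdef, Bop_sub i j hA0 hB0 c1 (c2.const_mul (a x)),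
      Bop_const_mul, hf i j 0 1 r hr _ (G.bdd x), hf i j 2 0 r hr _ (G.bdd x)]
    simp
  have hrk : 0 < r ^ κ := Real.rpow_pos_of_pos hr κ
  set N := C0 * (e⁻¹) ^ 6 * (Mb + Mbb) * (r ^ κ * (r⁻¹) ^ 2) with hN
  have hN0 : 0 ≤ N := by positivity
  have hgr : ∀ y, |f y - f x| ≤ N * (1 + pdist y x / r) ^ 4 := by
    intro y
    have hd := pdist_nonneg y x
    have h1 := one_add_div_mul_le (d := pdist y x) h0 he1 hr
    have h2 : (e * r) ^ κ ≤ r ^ κ :=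
      Real.rpow_le_rpow her.le (by nlinarith) (by linarith [P.one_lt])
    calc |f y - f x| ≤ C0 * (Mb + Mbb) * ((e * r) ^ κ * ((e * r)⁻¹) ^ 2) *
          (1 + pdist y x / (e * r)) ^ 4 := hC0 G x (e * r) her her1 y
      _ ≤ C0 * (Mb + Mbb) * (r ^ κ * ((e * r)⁻¹) ^ 2) * (e⁻¹ * (1 + pdist y x / r)) ^ 4 := by
          gcongr
      _ = _ := by rw [hN, mul_inv]; ring
  have cf' := (cf.sub (bddCont_const (f x))).1
  have g1 := (hC1 A' hA' B' hB' r hr _ x z N cf' hgr).2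
  have g2 := (hC2 A' hA' B' hB' r hr _ x z N cf' hgr).2
  have hid : Bop i (j + 2) (s * r) (1 * r ^ 2) (U x) z -
      a x ^ 2 * Bop (i + 4) j (s * r) (1 * r ^ 2) (U x) z =
      Bop i (j + 1) (A' * r) (B' * r ^ 2) (fun y => f y - f x) z +
        a x * Bop (i + 2) j (A' * r) (B' * r ^ 2) (fun y => f y - f x) z := by
    rw [hop i (j + 1) (by omega), hop (i + 2) j (by omega)]
    ring
  rw [hid]
  have hd := pdist_nonneg z x
  set D := (1 + pdist z x / r) ^ 4 with hD
  have hD0 : 0 ≤ D := by positivity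
  have hpi : r ^ 3 / Real.pi ^ 2 ≤ r ^ 3 :=
    div_le_self (by positivity) (by nlinarith [Real.pi_gt_three])
  calc _ ≤ r ^ 3 * (C1 * (r⁻¹) ^ (i + 2 * (j + 1)) * N * D +
        lam⁻¹ * (C2 * (r⁻¹) ^ (i + 2 + 2 * j) * N * D)) := by
        rw [abs_mul, abs_of_nonneg (by positivity : 0 ≤ r ^ 3 / Real.pi ^ 2)]
        refine mul_le_mul hpi ((abs_add_le _ _).trans (add_le_add g1 ?_)) (abs_nonneg _)
          (by positivity)
        rw [abs_mul, abs_of_pos ha0]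
        gcongr
        exact (G.ellip x).2
    _ = _ := by
        rw [hN, show i + 2 * (j + 1) = (i + 2 * j) + 2 by ring,
          show i + 2 + 2 * j = (i + 2 * j) + 2 by ring, pow_add _ (i + 2 * j) 2,
          pow_succ _ (i + 2 * j)]
        field_simp

lemma Germ.adapted_one_le (P : Params lam κ A) (i j : ℕ) (hij : 1 ≤ i + j) : ∃ C : ℝ, 0 < C ∧
    ∀ {U a γ Mb Mbb}, Germ lam κ A U a γ Mb Mbb → ∀ x z,
      |Bop i j (spScale (a x) * 1) (1 * 1 ^ 2) (U x) z| ≤ C * (Mb + Mbb) := by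
  have h0 := P.half_pos
  obtain ⟨C0, hC00, hC0⟩ := Germ.osc_le P
  obtain ⟨C1, hC10, hC1⟩ := Bop_growth i j 0 (lam / 2) (3 / lam) h0
  set e := lam / 2 with he
  have he1 : e ≤ 1 := P.one_mem.1
  refine ⟨C1 * (C0 * (e⁻¹) ^ 2), by positivity, fun {U a γ Mb Mbb} G x z => ?_⟩
  obtain ⟨A', hA', B', hB', hf⟩ := P.exists_factor (G.ellip x)
  have her : 0 < e * 1 := by positivity
  have her2 : 0 < (e * 1) ^ 2 := by positivity
  set w := Bop 0 0 (e * 1) ((e * 1) ^ 2) (U x) with hw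
  have cw : BddCont w := bddCont_Bop 0 0 her her2 (G.bdd x)
  have h := (hC1 A' hA' B' hB' 1 one_pos (fun y => w y - w z) z z
    (C0 * (Mb + Mbb) * ((e * 1)⁻¹) ^ 2) (cw.sub (bddCont_const (w z))).1 fun y => by
      rw [pow_zero, mul_one]
      exact hC0 G x (e * 1) her (by rwa [mul_one]) y z).2
  rw [Bop_sub_const i j hij (mul_pos (h0.trans_le hA'.1) one_pos)
    (mul_pos (h0.trans_le hB'.1) (by norm_num)) cw, hw, hf i j 0 0 1 one_pos _ (G.bdd x)] at h
  refine h.trans (le_of_eq ?_)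
  simp
  ring

lemma Germ.adapted_second_le (P : Params lam κ A) (i j : ℕ) (hij : i + 2 * j = 2) :
    ∃ C : ℝ, 0 < C ∧
    ∀ {U a γ Mb Mbb}, Germ lam κ A U a γ Mb Mbb → ∀ x r, 0 < r → r ≤ 1 → ∀ z,
      |Bop i j (spScale (a x) * r) (1 * r ^ 2) (U x) z| ≤
        C * (Mb + Mbb) * r ^ (κ - 2) * (1 + pdist z x / r) ^ 4 := by
  obtain ⟨C0, hC00, hC0⟩ := Germ.adapted_one_le P i j (by omega)
  obtain ⟨C1, hC10, hC1⟩ := Germ.adapted_deriv_le P i j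
  have hκ := P.lt_two
  have hκ' : 0 < -(κ - 2) := by linarith
  refine ⟨C0 + C1 / (-(κ - 2)), by positivity, fun {U a γ Mb Mbb} G x r hr hr1 z => ?_⟩
  have hMb := G.nonneg
  have hMbb := G.nonneg'
  have hd := pdist_nonneg z x
  have hs0 := P.half_pos.trans_le (P.spScale_mem (G.ellip x)).1
  set D := (1 + pdist z x / r) ^ 4 with hD
  have hD1 : 1 ≤ D := one_le_pow₀ (by linarith [show 0 ≤ pdist z x / r by positivity])
  have key := abs_le_of_rpow_deriv (p := κ - 2) (K := C1 * (Mb + Mbb) * D) (by positivity)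
    (by linarith) hr hr1
    (fun s hs _ => hasDerivAt_adapted i j hs0 (G.bdd x) z (hr.trans_le hs))
    (fun s hs hs1 => by
      have hs' := hr.trans_le hs
      refine (hC1 G x s hs' hs1 z).trans ?_
      have e1 : s ^ κ * (s⁻¹) ^ (i + 2 * j + 1) = s ^ (κ - 2 - 1) := by
        rw [hij, inv_pow, ← div_eq_mul_inv, ← Real.rpow_sub_natCast hs'.ne']
        norm_num
        ring_nf
      have e2 : (1 + pdist z x / s) ^ 4 ≤ D := by rw [hD]; gcongr
      rw [e1]
      have : 0 ≤ s ^ (κ - 2 - 1) := by positivity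
      calc _ ≤ C1 * (Mb + Mbb) * s ^ (κ - 2 - 1) * D := by gcongr
        _ = _ := by ring)
  refine key.trans ?_
  have h1 : 1 ≤ r ^ (κ - 2) := Real.one_le_rpow_of_pos_of_le_one_of_nonpos hr hr1 (by linarith)
  calc _ ≤ C0 * (Mb + Mbb) + C1 * (Mb + Mbb) * D / (-(κ - 2)) * r ^ (κ - 2) := by
        gcongr
        exact hC0 G x z
    _ = C0 * (Mb + Mbb) * 1 + C1 / (-(κ - 2)) * (Mb + Mbb) * r ^ (κ - 2) * D := by ring
    _ ≤ C0 * (Mb + Mbb) * (r ^ (κ - 2) * D) + C1 / (-(κ - 2)) * (Mb + Mbb) * r ^ (κ - 2) * D := by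
        have : 1 ≤ r ^ (κ - 2) * D := one_le_mul_of_one_le_of_one_le h1 hD1
        gcongr
    _ = _ := by ring

lemma Germ.adapted_value_le (P : Params lam κ A) : ∃ C : ℝ, 0 < C ∧
    ∀ {U a γ Mb Mbb}, Germ lam κ A U a γ Mb Mbb → ∀ x r, 0 < r → r ≤ 1 →
      |Bop 0 0 (spScale (a x) * r) (1 * r ^ 2) (U x) x - U x x| ≤ C * (Mb + Mbb) * r ^ κ := by
  obtain ⟨C1, hC10, hC1⟩ := Germ.adapted_deriv_le P 0 0
  have hκ : 0 < κ := by linarith [P.one_lt]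
  refine ⟨C1 / κ, by positivity, fun {U a γ Mb Mbb} G x r hr hr1 => ?_⟩
  have hM : 0 ≤ Mb + Mbb := add_nonneg G.nonneg G.nonneg'
  have hs0 := P.half_pos.trans_le (P.spScale_mem (G.ellip x)).1
  have key : ∀ s, 0 < s → s ≤ r → _ := fun s hs hsr => abs_sub_le_of_rpow_deriv (p := κ)
    (K := C1 * (Mb + Mbb)) (by positivity) hκ
    (fun s hs _ => hasDerivAt_adapted 0 0 hs0 (G.bdd x) x hs)
    (fun s hs hs1 => by
      refine (hC1 G x s hs hs1 x).trans (le_of_eq ?_)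
      rw [Real.rpow_sub_one hs.ne', pdist_self]
      simp [div_eq_mul_inv]) hs hsr hr1
  have ht := ((tendsto_Bop_zero hs0 one_pos (G.bdd x) x).const_sub
    (Bop 0 0 (spScale (a x) * r) (1 * r ^ 2) (U x) x)).abs
  refine le_of_tendsto ht ?_
  filter_upwards [Ioc_mem_nhdsGT hr] with s hs
  refine (key s hs.1 hs.2).trans (le_of_eq ?_)
  ring

lemma Germ.adapted_slope_le (P : Params lam κ A) : ∃ C : ℝ, 0 < C ∧
    ∀ {U a γ Mb Mbb}, Germ lam κ A U a γ Mb Mbb → ∀ x, ∃ ν : ℝ, ∀ r, 0 < r → r ≤ 1 →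
      |Bop 1 0 (spScale (a x) * r) (1 * r ^ 2) (U x) x - ν| ≤ C * (Mb + Mbb) * r ^ (κ - 1) := by
  obtain ⟨C1, hC10, hC1⟩ := Germ.adapted_deriv_le P 1 0
  have hκ : 0 < κ - 1 := by linarith [P.one_lt]
  refine ⟨C1 / (κ - 1), by positivity, fun {U a γ Mb Mbb} G x => ?_⟩
  have hM : 0 ≤ Mb + Mbb := add_nonneg G.nonneg G.nonneg'
  have hs0 := P.half_pos.trans_le (P.spScale_mem (G.ellip x)).1
  refine exists_limit_of_abs_sub_le (F := fun r => Bop 1 0 (spScale (a x) * r) (1 * r ^ 2) (U x) x)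
    (g := fun r => C1 / (κ - 1) * (Mb + Mbb) * r ^ (κ - 1)) fun s t hs hst ht => ?_
  refine (abs_sub_le_of_rpow_deriv (p := κ - 1) (K := C1 * (Mb + Mbb)) (by positivity) hκ
    (fun s hs _ => hasDerivAt_adapted 1 0 hs0 (G.bdd x) x hs)
    (fun s hs hs1 => ?_) hs hst ht).trans (le_of_eq (by ring))
  refine (hC1 G x s hs hs1 x).trans (le_of_eq ?_)
  rw [Real.rpow_sub_one hs.ne', Real.rpow_sub_one hs.ne', pdist_self]
  simp only [zero_div, add_zero, one_pow, mul_one]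
  ring

end

/-! ### Local modelledness -/

lemma abs_sub_le_of_hasDerivAt_uIcc {f f' : ℝ → ℝ} {a b K : ℝ}
    (h : ∀ s ∈ Set.uIcc a b, HasDerivAt f (f' s) s) (hb : ∀ s ∈ Set.uIcc a b, |f' s| ≤ K) :
    |f b - f a| ≤ K * |b - a| :=
  (convex_uIcc a b).norm_image_sub_le_of_norm_hasDerivWithin_le
    (fun s hs => (h s hs).hasDerivWithinAt) hb Set.left_mem_uIcc Set.right_mem_uIcc

lemma abs_sub_le_of_mem_uIcc {a b s : ℝ} (hs : s ∈ Set.uIcc a b) : |s - a| ≤ |b - a| :=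
  Set.abs_sub_left_of_mem_uIcc hs

lemma parabolic_taylor {v v1 v11 v2 : ℝ × ℝ → ℝ} {x z : ℝ × ℝ} {K : ℝ}
    (d1 : ∀ s t, HasDerivAt (fun s => v (s, t)) (v1 (s, t)) s)
    (d11 : ∀ s t, HasDerivAt (fun s => v1 (s, t)) (v11 (s, t)) s)
    (d2 : ∀ s t, HasDerivAt (fun t => v (s, t)) (v2 (s, t)) t)
    (h11 : ∀ p, pdist p x ≤ pdist z x → |v11 p| ≤ K)
    (h2 : ∀ p, pdist p x ≤ pdist z x → |v2 p| ≤ K) :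
    |v z - v x - v1 x * (z.1 - x.1)| ≤ 2 * K * pdist z x ^ 2 := by
  have hK : 0 ≤ K := (abs_nonneg _).trans (h11 z le_rfl)
  have hd := pdist_nonneg z x
  have hx := abs_fst_sub_le_pdist z x
  have ht := abs_snd_sub_le_pdist_sq z x
  have near : ∀ s ∈ Set.uIcc x.1 z.1, pdist (s, x.2) x ≤ pdist z x := by
    intro s hs
    have h1 := abs_sub_le_of_mem_uIcc hs
    have h3 : 0 ≤ √|z.2 - x.2| := Real.sqrt_nonneg _
    simp only [pdist, sub_self, abs_zero, Real.sqrt_zero]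
    linarith
  have near' : ∀ t ∈ Set.uIcc x.2 z.2, pdist (z.1, t) x ≤ pdist z x := by
    intro t ht
    have h1 := Real.sqrt_le_sqrt (abs_sub_le_of_mem_uIcc ht)
    simp only [pdist]
    linarith
  have e1 : ∀ s ∈ Set.uIcc x.1 z.1, |v1 (s, x.2) - v1 x| ≤ K * pdist z x := by
    intro s hs
    have hsub := Set.uIcc_subset_uIcc_left hs
    refine (abs_sub_le_of_hasDerivAt_uIcc (f := fun s => v1 (s, x.2)) (a := x.1) (b := s)
      (fun s _ => d11 s x.2) fun s' hs' => h11 _ (near s' (hsub hs'))).trans ?_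
    have h1 := abs_sub_le_of_mem_uIcc hs
    gcongr
    linarith
  have e2 := abs_sub_le_of_hasDerivAt_uIcc (f := fun s => v (s, x.2) - v1 x * s) (a := x.1)
    (b := z.1) (fun s _ => (d1 s x.2).sub ((hasDerivAt_id s).const_mul (v1 x)))
    (fun s hs => by simpa using e1 s hs)
  have e3 := abs_sub_le_of_hasDerivAt_uIcc (f := fun t => v (z.1, t)) (a := x.2) (b := z.2)
    (fun t _ => d2 z.1 t) fun t ht => h2 _ (near' t ht)
  have e2' : |v (z.1, x.2) - v1 x * z.1 - (v (x.1, x.2) - v1 x * x.1)| ≤ K * pdist z x ^ 2 := by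
    refine e2.trans ?_
    rw [sq, ← mul_assoc]
    gcongr
  have e3' : |v (z.1, z.2) - v (z.1, x.2)| ≤ K * pdist z x ^ 2 := by
    refine e3.trans ?_
    gcongr
  have b2 := abs_le.mp e2'
  have b3 := abs_le.mp e3'
  rw [abs_le]
  constructor <;> linarith [b2.1, b2.2, b3.1, b3.2]

section

variable {lam κ : ℝ} {A : Finset ℝ}

lemma Germ.adapted_affine_le (P : Params lam κ A) : ∃ C : ℝ, 0 < C ∧
    ∀ {U a γ Mb Mbb}, Germ lam κ A U a γ Mb Mbb → ∀ x, ∃ ν : ℝ, ∀ r, 0 < r → r ≤ 1 → ∀ z,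
      |Bop 0 0 (spScale (a x) * r) (1 * r ^ 2) (U x) z - U x x - ν * (z.1 - x.1)| ≤
        C * (Mb + Mbb) * r ^ κ * (1 + pdist z x / r) ^ 6 := by
  obtain ⟨C0, hC00, hC0⟩ := Germ.adapted_value_le P
  obtain ⟨C1, hC10, hC1⟩ := Germ.adapted_slope_le P
  obtain ⟨C2, hC20, hC2⟩ := Germ.adapted_second_le P 2 0 rfl
  obtain ⟨C3, hC30, hC3⟩ := Germ.adapted_second_le P 0 1 rfl
  refine ⟨C0 + C1 + 2 * (C2 + C3), by positivity, fun {U a γ Mb Mbb} G x => ?_⟩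
  obtain ⟨ν, hν⟩ := hC1 G x
  refine ⟨ν, fun r hr hr1 z => ?_⟩
  have hMb := G.nonneg
  have hMbb := G.nonneg'
  have hd := pdist_nonneg z x
  have hs0 := P.half_pos.trans_le (P.spScale_mem (G.ellip x)).1
  have hσ : 0 < spScale (a x) * r := mul_pos hs0 hr
  have hτ : 0 < 1 * r ^ 2 := by positivity
  set q := pdist z x / r with hq
  have hq0 : 0 ≤ q := by positivity
  have hdq : pdist z x = r * q := by rw [hq]; field_simp
  have hrk : 0 < r ^ κ := Real.rpow_pos_of_pos hr κ
  set K := (C2 + C3) * (Mb + Mbb) * r ^ (κ - 2) * (1 + q) ^ 4 with hK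
  have hgr : ∀ p, pdist p x ≤ pdist z x → (1 + pdist p x / r) ^ 4 ≤ (1 + q) ^ 4 := by
    intro p hp
    have := pdist_nonneg p x
    rw [hq]
    gcongr
  have hT := parabolic_taylor (x := x) (z := z) (K := K) (hasDerivAt_Bop_fst 0 0 hσ hτ (G.bdd x))
    (hasDerivAt_Bop_fst 1 0 hσ hτ (G.bdd x)) (hasDerivAt_Bop_snd 0 0 hσ hτ (G.bdd x))
    (fun p hp => by
      refine (hC2 G x r hr hr1 p).trans ?_
      have := hgr p hp
      have : C2 ≤ C2 + C3 := by linarith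
      rw [hK]
      gcongr)
    (fun p hp => by
      refine (hC3 G x r hr hr1 p).trans ?_
      have := hgr p hp
      have : C3 ≤ C2 + C3 := by linarith
      rw [hK]
      gcongr)
  have b0 := hC0 G x r hr hr1
  have b1 : |(Bop 1 0 (spScale (a x) * r) (1 * r ^ 2) (U x) x - ν) * (z.1 - x.1)| ≤
      C1 * (Mb + Mbb) * r ^ κ * q := by
    rw [abs_mul]
    calc _ ≤ C1 * (Mb + Mbb) * r ^ (κ - 1) * (r * q) := by
          gcongr
          · exact hν r hr hr1
          · rw [← hdq]; exact abs_fst_sub_le_pdist z x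
      _ = _ := by rw [Real.rpow_sub_one hr.ne']; field_simp
  have b2 : 2 * K * pdist z x ^ 2 =
      2 * (C2 + C3) * (Mb + Mbb) * r ^ κ * ((1 + q) ^ 4 * q ^ 2) := by
    have e : r ^ (κ - 2) * r ^ 2 = r ^ κ := by
      rw [← Real.rpow_natCast r 2, ← Real.rpow_add hr]; norm_num
    rw [hK, hdq, ← e]; ring
  have p1 : 1 ≤ (1 + q) ^ 6 := one_le_pow₀ (by linarith)
  have p2 : q ≤ (1 + q) ^ 6 :=
    (by linarith : q ≤ 1 + q).trans (le_self_pow₀ (by linarith) (by norm_num))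
  have p3 : (1 + q) ^ 4 * q ^ 2 ≤ (1 + q) ^ 6 := by
    calc _ ≤ (1 + q) ^ 4 * (1 + q) ^ 2 := by gcongr; linarith
      _ = _ := by ring
  rw [b2] at hT
  have t0 : C0 * (Mb + Mbb) * r ^ κ ≤ C0 * (Mb + Mbb) * r ^ κ * (1 + q) ^ 6 :=
    le_mul_of_one_le_right (by positivity) p1
  have t1 : C1 * (Mb + Mbb) * r ^ κ * q ≤ C1 * (Mb + Mbb) * r ^ κ * (1 + q) ^ 6 := by gcongr
  have t2 : 2 * (C2 + C3) * (Mb + Mbb) * r ^ κ * ((1 + q) ^ 4 * q ^ 2) ≤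
      2 * (C2 + C3) * (Mb + Mbb) * r ^ κ * (1 + q) ^ 6 := by gcongr
  have a0 := abs_le.mp (b0.trans t0)
  have a1 := abs_le.mp (b1.trans t1)
  have a2 := abs_le.mp (hT.trans t2)
  rw [abs_le]
  constructor <;> linarith [a0.1, a0.2, a1.1, a1.2, a2.1, a2.2]

lemma Germ.local_modelled (P : Params lam κ A) : ∃ C : ℝ, 0 < C ∧
    ∀ {U a γ Mb Mbb}, Germ lam κ A U a γ Mb Mbb → ∃ ν : ℝ × ℝ → ℝ, ∀ x y, pdist y x ≤ 2 →
      |U x y - U x x - ν x * (y.1 - x.1)| ≤ C * (Mb + Mbb) * pdist y x ^ κ := by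
  have h0 := P.half_pos
  obtain ⟨C0, hC00, hC0⟩ := Germ.adapted_affine_le P
  obtain ⟨C1, hC10, hC1⟩ := Bop_growth 0 0 6 (lam / 2) (3 / lam) h0
  obtain ⟨C2, hC20, hC2⟩ := Bop_growth 0 0 2 (lam / 2) (3 / lam) h0
  have hlam := P.lam_pos
  obtain ⟨hB, hB2⟩ := P.timeScale_mem
  set e := lam / 2 with he
  have he1 : e ≤ 1 := P.one_mem.1
  refine ⟨C0 + C2 * A.card + C1 * (C0 * (e⁻¹) ^ 6) * 3 ^ 6, by positivity,
    fun {U a γ Mb Mbb} G => ?_⟩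
  choose ν hν using hC0 G
  refine ⟨ν, fun x y hR2 => ?_⟩
  have hMb := G.nonneg
  have hMbb := G.nonneg'
  have hκ : 0 < κ := by linarith [P.one_lt]
  rcases eq_or_ne y x with rfl | hyx
  · rw [pdist_self, Real.zero_rpow hκ.ne']; simp
  have hR := pdist_pos hyx
  set R := pdist y x with hRdef
  set r := R / 2 with hr
  have hr0 : 0 < r := by positivity
  have hr1 : r ≤ 1 := by linarith
  have hrk : 0 < R ^ κ := Real.rpow_pos_of_pos hR κ
  have hrR : r ^ κ ≤ R ^ κ := Real.rpow_le_rpow hr0.le (by linarith) hκ.le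
  have hsy := P.spScale_mem (G.ellip y)
  have hsy0 := h0.trans_le hsy.1
  have hsx0 := h0.trans_le (P.spScale_mem (G.ellip x)).1
  set s := spScale (a y) with hs
  set Q : (ℝ × ℝ → ℝ) → ℝ := fun u => Bop 0 0 (s * r) (1 * r ^ 2) u y with hQ
  -- the germ based at `y`
  have i1 : |Q (U y) - U y y| ≤ C0 * (Mb + Mbb) * R ^ κ := by
    have := hν y r hr0 hr1 y
    rw [sub_self, mul_zero, sub_zero, pdist_self, zero_div, add_zero, one_pow, mul_one] at this
    refine this.trans ?_
    gcongr
  -- the change of base point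
  have i2 : |Q (U x) - Q (U y) - (U x y - U y y)| ≤ C2 * A.card * Mbb * R ^ κ := by
    have hb := (G.bdd x).sub (G.bdd y)
    have hg := (hC2 s hsy 1 P.one_mem r hr0
      (fun z => U x z - U y z - (U x y - U y y) - γ x y * (z.1 - y.1)) y y
      (Mbb * (A.card * R ^ κ)) (by have := hb.1; fun_prop) fun z => by
        have hz := pdist_nonneg z y
        calc _ = |U x z - U x y - U y z + U y y - γ x y * (z.1 - y.1)| := by congr 1; ring
          _ ≤ _ := G.threePoint x y z
          _ ≤ Mbb * (A.card * (R ^ κ * (1 + pdist z y / R) ^ 2)) := by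
            gcongr
            exact P.sum_le_growth hR hz
          _ ≤ Mbb * (A.card * (R ^ κ * (1 + pdist z y / r) ^ 2)) := by
            gcongr
            linarith
          _ = _ := by ring).2
    rw [Bop_sub_affine hsy0 one_pos hr0 hb, Bop_sub 0 0 (by positivity) (by positivity)
      (G.bdd x) (G.bdd y), sub_self, mul_zero, sub_zero, pdist_self] at hg
    refine hg.trans (le_of_eq ?_)
    simp
    ring
  -- the germ based at `x`, seen from `y`
  have i3 : |Q (U x) - U x x - ν x * (y.1 - x.1)| ≤
      C1 * (C0 * (e⁻¹) ^ 6) * 3 ^ 6 * (Mb + Mbb) * R ^ κ := by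
    have her : 0 < e * r := by positivity
    set v := Bop 0 0 (spScale (a x) * (e * r)) (1 * (e * r) ^ 2) (U x) with hv
    have cv : BddCont v := bddCont_Bop 0 0 (by positivity) (by positivity) (G.bdd x)
    obtain ⟨hA, hA4⟩ := P.root4_sub_mem (G.ellip y) (X := 4 * Real.pi ^ 2 * a x ^ 2 * e ^ 4)
      (by positivity) (by
        obtain ⟨hx1, hx2⟩ := G.ellip x
        have hy1 := (G.ellip y).1
        have h1 : a x * e ≤ 1 / 2 := by
          calc a x * e ≤ lam⁻¹ * e := by gcongr
            _ = 1 / 2 := by rw [he]; field_simp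
        have h2 : e ≤ a y / 2 := by rw [he]; linarith
        have h3 : 0 ≤ a x * e := mul_nonneg (hlam.le.trans hx1) h0.le
        have h4 : (a x * e) ^ 2 * e ^ 2 ≤ (1 / 2) ^ 2 * (a y / 2) ^ 2 := by gcongr
        have h5 : 0 ≤ Real.pi ^ 2 * a y ^ 2 := by positivity
        have h6 := mul_le_mul_of_nonneg_left h4 (by positivity : 0 ≤ 4 * Real.pi ^ 2)
        linarith)
    set A' := root4 (4 * Real.pi ^ 2 * a y ^ 2 - 4 * Real.pi ^ 2 * a x ^ 2 * e ^ 4) with hA'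
    set B' := √(1 - e ^ 4) with hB'
    have hA0 := h0.trans_le hA.1
    have hB0 := h0.trans_le hB.1
    have hcomp : Bop 0 0 (A' * r) (B' * r ^ 2) v y = Q (U x) := by
      rw [hv, hQ]
      refine Bop_Bop 0 0 0 0 (by positivity) (by positivity) (by positivity) (by positivity)
        (by positivity) (by positivity) ?_ ?_ (G.bdd x) y
      · rw [mul_pow, mul_pow, mul_pow, hA4, spScale_pow]; ring
      · rw [mul_pow B', hB2]; ring
    have hg := (hC1 A' hA B' hB r hr0 (fun z => v z - U x x - ν x * (z.1 - x.1)) x y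
      (C0 * (e⁻¹) ^ 6 * (Mb + Mbb) * R ^ κ) (by have := cv.1; fun_prop) fun z => by
        have hz := pdist_nonneg z x
        have h1 := one_add_div_mul_le (d := pdist z x) h0 he1 hr0
        have h2 : (e * r) ^ κ ≤ R ^ κ := Real.rpow_le_rpow her.le (by nlinarith) hκ.le
        calc _ ≤ C0 * (Mb + Mbb) * (e * r) ^ κ * (1 + pdist z x / (e * r)) ^ 6 :=
              hν x (e * r) her (by nlinarith) z
          _ ≤ C0 * (Mb + Mbb) * R ^ κ * (e⁻¹ * (1 + pdist z x / r)) ^ 6 := by gcongr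
          _ = _ := by ring).2
    rw [Bop_sub_affine hA0 hB0 hr0 cv, hcomp] at hg
    refine hg.trans (le_of_eq ?_)
    rw [← hRdef, show R / r = 2 by rw [hr]; field_simp]
    norm_num
    ring
  have j1 := abs_le.mp i1
  have j2 := abs_le.mp i2
  have j3 := abs_le.mp i3
  have p : 0 ≤ C2 * A.card * Mb * R ^ κ := by positivity
  rw [abs_le]
  constructor <;> linarith [j1.1, j1.2, j2.1, j2.2, j3.1, j3.2]

end

/-! ### Global modelledness and the three-point consequence -/

section

variable {lam κ : ℝ} {A : Finset ℝ}

lemma pdist_add_fst (y : ℝ × ℝ) {d : ℝ} (hd : 0 ≤ d) : pdist (y.1 + d, y.2) y = d := by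
  simp [pdist, abs_of_nonneg hd]

lemma Germ.modelled (P : Params lam κ A) : ∃ C : ℝ, 0 < C ∧
    ∀ {U a γ Mb Mbb}, Germ lam κ A U a γ Mb Mbb → ∃ ν : ℝ × ℝ → ℝ, ∀ x y,
      |U x y - U x x - ν x * (y.1 - x.1)| ≤ C * (Mb + Mbb) * pdist y x ^ κ := by
  obtain ⟨C, hC0, hC⟩ := Germ.local_modelled P
  refine ⟨4 * C, by positivity, fun {U a γ Mb Mbb} G => ?_⟩
  obtain ⟨ν, hν⟩ := hC G
  refine ⟨ν, fun x y => ?_⟩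
  have hMb := G.nonneg
  have hMbb := G.nonneg'
  set K := C * (Mb + Mbb) with hK
  have hK0 : 0 ≤ K := by positivity
  have hslope : |ν x| ≤ K := by
    have h := hν x (x.1 + 1, x.2) (by rw [pdist_add_fst x zero_le_one]; norm_num)
    have e : U x (x.1 + 1, x.2) = U x x := by
      simpa using PeriodicFn.add_fst (G.per x) x.1 x.2 1
    rw [e, pdist_add_fst x zero_le_one, Real.one_rpow] at h
    simpa using h
  have hd0 := pdist_nonneg y x
  rcases le_or_gt (pdist y x) 2 with hd | hd
  · refine (hν x y hd).trans ?_
    gcongr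
    linarith
  set y' : ℝ × ℝ := (x.1 + Int.fract (y.1 - x.1), x.2 + Int.fract (y.2 - x.2)) with hy'
  have e : U x y = U x y' := by
    rw [← G.per x y' (⌊y.1 - x.1⌋, ⌊y.2 - x.2⌋)]
    congr 1
    ext
    · simp only [hy']; rw [add_assoc, Int.fract_add_floor]; ring
    · simp only [hy']; rw [add_assoc, Int.fract_add_floor]; ring
  have f1 := fract_mem_Icc (y.1 - x.1)
  have f2 := fract_mem_Icc (y.2 - x.2)
  have hy1 : |y'.1 - x.1| ≤ 1 := by
    simp only [hy', add_sub_cancel_left]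
    rw [abs_of_nonneg f1.1]
    exact f1.2
  have hd' : pdist y' x ≤ 2 := by
    have : √|y'.2 - x.2| ≤ 1 := by
      simp only [hy', add_sub_cancel_left]
      rw [abs_of_nonneg f2.1]
      exact Real.sqrt_le_one.mpr f2.2
    simp only [pdist] at *
    linarith
  have h1 : |U x y' - U x x - ν x * (y'.1 - x.1)| ≤ K * 4 := by
    refine (hν x y' hd').trans ?_
    gcongr
    exact (Real.rpow_le_rpow (pdist_nonneg _ _) hd' (by linarith [P.one_lt])).trans P.two_rpow_le
  have h2 : |ν x * (y'.1 - x.1)| ≤ K * 1 := by rw [abs_mul]; gcongr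
  have h3 : |ν x * (y.1 - x.1)| ≤ K * pdist y x := by
    rw [abs_mul]
    gcongr
    exact abs_fst_sub_le_pdist y x
  have h4 : pdist y x ≤ pdist y x ^ κ := Real.self_le_rpow_of_one_le (by linarith) P.one_lt.le
  have h5 : K * (4 + 1 + pdist y x) ≤ K * (4 * pdist y x ^ κ) := by gcongr; linarith
  have b1 := abs_le.mp h1
  have b2 := abs_le.mp h2
  have b3 := abs_le.mp h3
  rw [e, abs_le]
  constructor <;> linarith [b1.1, b1.2, b2.1, b2.2, b3.1, b3.2]

lemma Germ.slope_increment_le (P : Params lam κ A) {U a γ Mb Mbb}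
    (G : Germ lam κ A U a γ Mb Mbb) {ν : ℝ × ℝ → ℝ} {N : ℝ} (hN : 0 ≤ N)
    (hν : ∀ x y, |U x y - U x x - ν x * (y.1 - x.1)| ≤ N * pdist y x ^ κ) {x y : ℝ × ℝ}
    (hxy : x ≠ y) :
    |ν y - ν x + γ x y| ≤ (6 * N + A.card * Mbb) * pdist y x ^ (κ - 1) := by
  have hd := pdist_pos hxy.symm
  set d := pdist y x with hdef
  have hκ : 0 ≤ κ := by linarith [P.one_lt]
  set z : ℝ × ℝ := (y.1 + d, y.2) with hz
  have hzy : pdist z y = d := pdist_add_fst y hd.le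
  have hzx : pdist z x ^ κ ≤ 4 * d ^ κ := by
    have h1 : pdist z x ≤ 2 * d := by
      have := pdist_triangle z y x
      linarith
    calc pdist z x ^ κ ≤ (2 * d) ^ κ := Real.rpow_le_rpow (pdist_nonneg z x) h1 hκ
      _ = 2 ^ κ * d ^ κ := Real.mul_rpow zero_le_two hd.le
      _ ≤ _ := by gcongr; exact P.two_rpow_le
  have hT := (G.threePoint x y z).trans (mul_le_mul_of_nonneg_left
    (P.sum_le hd.le (pdist_nonneg z y) hd le_rfl hzy.le) G.nonneg')
  have h1 := (hν x z).trans (mul_le_mul_of_nonneg_left hzx hN)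
  have h2 := hν x y
  have h3 := hν y z
  have e1 : z.1 - y.1 = d := by simp [hz]
  have e2 : z.1 - x.1 = d + (y.1 - x.1) := by simp only [hz]; ring
  rw [hzy] at h3
  rw [e1] at h3 hT
  rw [e2] at h1
  have b0 := abs_le.mp hT
  have b1 := abs_le.mp h1
  have b2 := abs_le.mp h2
  have b3 := abs_le.mp h3
  have key : |(ν y - ν x + γ x y) * d| ≤ (6 * N + A.card * Mbb) * d ^ κ := by
    rw [abs_le]
    constructor <;> linarith [b0.1, b0.2, b1.1, b1.2, b2.1, b2.2, b3.1, b3.2]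
  rw [abs_mul, abs_of_pos hd] at key
  rw [Real.rpow_sub_one hd.ne', ← mul_div_assoc, le_div_iff₀ hd]
  exact key

end

end ParabolicKernel

open ParabolicKernel

/-- **Integration.** -/
theorem integration (lam : ℝ) (hlam0 : 0 < lam) (hlam1 : lam < 1)
    (κ : ℝ) (hκ1 : 1 < κ) (hκ2 : κ < 2)
    (A : Finset ℝ) (hA : ∀ β ∈ A, 0 ≤ β ∧ β < κ) :
    ∃ C : ℝ, 0 < C ∧
      ∀ U : ℝ × ℝ → ℝ × ℝ → ℝ,
        (∃ B : ℝ, ∀ x y, |U x y| ≤ B) →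
        (∀ x, PeriodicFn (U x)) →
        (∀ x, Continuous (U x)) →
      ∀ a : ℝ × ℝ → ℝ, (∀ x, a x ∈ Set.Icc lam lam⁻¹) →
      ∀ Mb : ℝ, 0 ≤ Mb →
      -- local splitting condition (KS1)
        (∀ (x : ℝ × ℝ) (L T : ℝ), 0 < L → L ≤ 1 → 0 < T → T ^ (4⁻¹ : ℝ) ≤ 1 →
          ∃ c : ℝ, ∀ y : ℝ × ℝ, pdist x y ≤ L →
            (T ^ (4⁻¹ : ℝ)) ^ (2 : ℝ) *
                |pd2 (mollS T (U x)) y - a x * pd1 (pd1 (mollS T (U x))) y - c| ≤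
              Mb * ∑ β ∈ A, (T ^ (4⁻¹ : ℝ)) ^ β * L ^ (κ - β)) →
      ∀ γfn : ℝ × ℝ → ℝ × ℝ → ℝ,
        Continuous (fun p : (ℝ × ℝ) × (ℝ × ℝ) => γfn p.1 p.2) →
      ∀ Mbb : ℝ, 0 ≤ Mbb →
      -- three-point continuity (KS2)
        (∀ x y z : ℝ × ℝ,
          |U x z - U x y - U y z + U y y - γfn x y * (z.1 - y.1)| ≤
            Mbb * ∑ β ∈ A, pdist y x ^ β * pdist z y ^ (κ - β)) →
      ∃ ν : ℝ × ℝ → ℝ,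
        (∀ x y : ℝ × ℝ,
          |U x y - U x x - ν x * (y.1 - x.1)| ≤ C * (Mb + Mbb) * pdist y x ^ κ) ∧
        (∀ x : ℝ × ℝ, |ν x| ≤
          sSup {r : ℝ | ∃ x' y' : ℝ × ℝ, x' ≠ y' ∧
            r = |U x' y' - U x' x' - ν x' * (y'.1 - x'.1)| / pdist y' x' ^ κ}) ∧
        (∀ x y : ℝ × ℝ, x ≠ y →
          |ν y - ν x + γfn x y| ≤
            C * (sSup {r : ℝ | ∃ x' y' : ℝ × ℝ, x' ≠ y' ∧
                r = |U x' y' - U x' x' - ν x' * (y'.1 - x'.1)| / pdist y' x' ^ κ}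
              + Mbb) * pdist y x ^ (κ - 1)) ∧
        (∀ x y : ℝ × ℝ, x ≠ y →
          |ν y - ν x + γfn x y| ≤ C * (Mb + Mbb) * pdist y x ^ (κ - 1)) := by
  have P : Params lam κ A := ⟨hlam0, hlam1, hκ1, hκ2, hA⟩
  obtain ⟨C, hC0, hC⟩ := Germ.modelled P
  refine ⟨6 * C + 6 + A.card, by positivity, ?_⟩
  intro U ⟨B, hB⟩ hper hcont a ha Mb hMb hsplit γ _ Mbb hMbb hthree
  have hbdd : ∀ x, BddCont (U x) := fun x => ⟨hcont x, B, hB x⟩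
  have G : Germ lam κ A U a γ Mb Mbb := by
    refine ⟨hbdd, hper, ha, hMb, hMbb, fun x r L hr hr1 hL hL1 => ?_, hthree⟩
    have hroot : (r ^ 4) ^ (4⁻¹ : ℝ) = r := by
      simpa using Real.pow_rpow_inv_natCast hr.le (n := 4) (by norm_num)
    obtain ⟨c, hc⟩ := hsplit x L (r ^ 4) hL hL1 (by positivity) (by rwa [hroot])
    refine ⟨c, fun y hy => ?_⟩
    have h := hc y (by rwa [pdist_comm])
    have hr2 : 0 < r ^ 2 := by positivity
    rw [hroot, Real.rpow_two, mollS_eq hr, pd2_Bop 0 0 hr hr2 (hbdd x),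
      pd1_Bop 0 0 hr hr2 (hbdd x), pd1_Bop 1 0 hr hr2 (hbdd x)] at h
    rw [mul_right_comm, inv_pow, ← div_eq_mul_inv, le_div_iff₀ hr2, mul_comm]
    exact h
  obtain ⟨ν, hν⟩ := hC G
  set S := {r : ℝ | ∃ x' y' : ℝ × ℝ, x' ≠ y' ∧
    r = |U x' y' - U x' x' - ν x' * (y'.1 - x'.1)| / pdist y' x' ^ κ} with hS
  have hub : ∀ r ∈ S, r ≤ C * (Mb + Mbb) := by
    rintro _ ⟨x, y, hxy, rfl⟩
    rw [div_le_iff₀ (Real.rpow_pos_of_pos (pdist_pos hxy.symm) κ)]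
    exact hν x y
  have hbA : BddAbove S := ⟨_, hub⟩
  have hS0 : 0 ≤ sSup S := by
    refine Real.sSup_nonneg ?_
    rintro _ ⟨x, y, -, rfl⟩
    exact div_nonneg (abs_nonneg _) (Real.rpow_nonneg (pdist_nonneg y x) κ)
  have hSM : sSup S ≤ C * (Mb + Mbb) := Real.sSup_le hub (by positivity)
  have hνS : ∀ x y, |U x y - U x x - ν x * (y.1 - x.1)| ≤ sSup S * pdist y x ^ κ := by
    intro x y
    rcases eq_or_ne x y with rfl | hxy
    · rw [pdist_self, Real.zero_rpow (by linarith)]; simp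
    · rw [← div_le_iff₀ (Real.rpow_pos_of_pos (pdist_pos hxy.symm) κ)]
      exact le_csSup hbA ⟨x, y, hxy, rfl⟩
  have hcard : (0 : ℝ) ≤ A.card := Nat.cast_nonneg _
  refine ⟨ν, fun x y => (hν x y).trans ?_, fun x => ?_, fun x y hxy => ?_, fun x y hxy => ?_⟩
  · have := pdist_nonneg y x
    gcongr
    linarith
  · have h := hνS x (x.1 + 1, x.2)
    have e : U x (x.1 + 1, x.2) = U x x := by
      simpa using PeriodicFn.add_fst (hper x) x.1 x.2 1
    rw [e, pdist_add_fst x zero_le_one, Real.one_rpow] at h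
    simp only [sub_self, zero_sub, abs_neg, add_sub_cancel_left, mul_one] at h
    exact h
  · refine (G.slope_increment_le P hS0 hνS hxy).trans ?_
    have := pdist_nonneg y x
    gcongr
    nlinarith [mul_nonneg hcard hS0, mul_nonneg hC0.le hS0, mul_nonneg hC0.le hMbb]
  · refine (G.slope_increment_le P (by positivity) hν hxy).trans ?_
    have := pdist_nonneg y x
    gcongr
    nlinarith [mul_nonneg hcard hMb, mul_nonneg hC0.le hMbb]
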